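/- arXiv:1701.00552 — 3 statements merged into one kernel-verified Lean document; each statement's English description precedes it below -/
import Mathlib

section
/- A Banach space X has the relatively compact Dunford-Pettis property (DPrcP) if and only if every weakly null sequence in X which is a Dunford-Pettis set is norm null. -/
open Filter Topology Metric

noncomputable section

instance : Fact ((1:ENNReal) ≤ ⊤) := ⟨le_top⟩

/-- A sequence is weakly null if every continuous linear functional sends it to a null
sequence. -/
def WeaklyNull {X : Type*} [NormedAddCommGroup X] [NormedSpace ℝ X] (x : ℕ → X) : Prop :=
  ∀ f : X →L[ℝ] ℝ, Tendsto (fun n => f (x n)) atTop (𝓝 0)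

/-- A sequence of functionals is weak*-null if it tends to zero pointwise. -/
def WeakStarNull {X : Type*} [NormedAddCommGroup X] [NormedSpace ℝ X]
    (f : ℕ → X →L[ℝ] ℝ) : Prop :=
  ∀ x : X, Tendsto (fun n => f n x) atTop (𝓝 0)

/-- A norm bounded set is a Dunford-Pettis set if every weakly null sequence of functionals
converges to zero uniformly on it. -/
def IsDPSet {X : Type*} [NormedAddCommGroup X] [NormedSpace ℝ X] (A : Set X) : Prop :=
  Bornology.IsBounded A ∧
  ∀ f : ℕ → X →L[ℝ] ℝ, WeaklyNull f →
    Tendsto (fun n => ⨆ x : A, |f n (x : X)|) atTop (𝓝 0)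

/-- A norm bounded subset of the dual is an L-set if every weakly null sequence in `X`
converges to zero uniformly on it. -/
def IsLSet {X : Type*} [NormedAddCommGroup X] [NormedSpace ℝ X]
    (A : Set (X →L[ℝ] ℝ)) : Prop :=
  Bornology.IsBounded A ∧
  ∀ x : ℕ → X, WeaklyNull x →
    Tendsto (fun n => ⨆ f : A, |(f : X →L[ℝ] ℝ) (x n)|) atTop (𝓝 0)

/-- A norm bounded subset of the dual is an L-Dunford-Pettis set if every weakly null
sequence in `X` which is a Dunford-Pettis set converges to zero uniformly on it. -/
def IsLDPSet {X : Type*} [NormedAddCommGroup X] [NormedSpace ℝ X]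
    (A : Set (X →L[ℝ] ℝ)) : Prop :=
  Bornology.IsBounded A ∧
  ∀ x : ℕ → X, WeaklyNull x → IsDPSet (Set.range x) →
    Tendsto (fun n => ⨆ f : A, |(f : X →L[ℝ] ℝ) (x n)|) atTop (𝓝 0)

/-- A set is relatively weakly compact if its closure in the weak topology is compact. -/
def RelWeaklyCompact {X : Type*} [NormedAddCommGroup X] [NormedSpace ℝ X]
    (A : Set X) : Prop :=
  IsCompact (closure ((toWeakSpace ℝ X) '' A))

/-- The relatively compact Dunford-Pettis property: every Dunford-Pettis set is
relatively norm compact. -/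
def HasDPrcP (X : Type*) [NormedAddCommGroup X] [NormedSpace ℝ X] : Prop :=
  ∀ A : Set X, IsDPSet A → IsCompact (closure A)

/-- An operator is Dunford-Pettis completely continuous if it maps weakly null sequences
that are Dunford-Pettis sets to norm null sequences. -/
def IsDPcc {X Y : Type*} [NormedAddCommGroup X] [NormedSpace ℝ X]
    [NormedAddCommGroup Y] [NormedSpace ℝ Y] (T : X →L[ℝ] Y) : Prop :=
  ∀ x : ℕ → X, WeaklyNull x → IsDPSet (Set.range x) →
    Tendsto (fun n => ‖T (x n)‖) atTop (𝓝 0)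

/-- An operator is weakly compact if the image of the closed unit ball is relatively
weakly compact. -/
def IsWeaklyCompactOp {X Y : Type*} [NormedAddCommGroup X] [NormedSpace ℝ X]
    [NormedAddCommGroup Y] [NormedSpace ℝ Y] (T : X →L[ℝ] Y) : Prop :=
  RelWeaklyCompact (T '' closedBall 0 1)

/-- The L-Dunford-Pettis property: every L-Dunford-Pettis set in the dual is relatively
weakly compact. -/
def HasLDPProperty (X : Type*) [NormedAddCommGroup X] [NormedSpace ℝ X] : Prop :=
  ∀ A : Set (X →L[ℝ] ℝ), IsLDPSet A → RelWeaklyCompact A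

/-- The Dunford-Pettis property: every relatively weakly compact set is a
Dunford-Pettis set. -/
def HasDPProperty (X : Type*) [NormedAddCommGroup X] [NormedSpace ℝ X] : Prop :=
  ∀ A : Set X, RelWeaklyCompact A → IsDPSet A

/-- Grothendieck space: every weak*-null sequence in the dual is weakly null. -/
def IsGrothendieck (X : Type*) [NormedAddCommGroup X] [NormedSpace ℝ X] : Prop :=
  ∀ f : ℕ → X →L[ℝ] ℝ, WeakStarNull f → WeaklyNull f

/-- The space `ℓ∞` of bounded real sequences. -/
abbrev ellInfty : Type := lp (fun _ : ℕ => ℝ) ⊤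

/-! ### Diagonalisation and The Rosenthal dichotomy -/

/-- Diagonal construction. -/
theorem diag_aux (R : ℕ → ℕ → Set ℕ → Prop) (N0 : Set ℕ) (h0 : N0.Infinite)
    (h : ∀ i N, N ⊆ N0 → N.Infinite → ∃ j ∈ N, ∃ N' ⊆ N, N'.Infinite ∧ R i j N') :
    ∃ (l : ℕ → ℕ) (M : ℕ → Set ℕ), StrictMono l ∧ (∀ i, l i ∈ N0) ∧
      (∀ i, R i (l i) (M i)) ∧ ∀ i k, i < k → l k ∈ M i := by
  choose! j hj N' hN' hinf hR using h
  let st : ℕ → Set ℕ := fun i => Nat.rec N0 (fun i N => N' i N ∩ Set.Ioi (j i N)) i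
  have st_succ : ∀ i, st (i+1) = N' i (st i) ∩ Set.Ioi (j i (st i)) := fun i => rfl
  have key : ∀ i, st i ⊆ N0 ∧ (st i).Infinite := by
    intro i
    induction i with
    | zero => exact ⟨subset_rfl, h0⟩
    | succ i ih =>
      rw [st_succ]
      refine ⟨fun x hx => ih.1 (hN' i _ ih.1 ih.2 hx.1), ?_⟩
      have := (hinf i _ ih.1 ih.2).sdiff (Set.finite_Iic (j i (st i)))
      refine this.mono ?_
      rintro x ⟨hx, hx'⟩
      exact ⟨hx, by simpa using hx'⟩
  have hsub : ∀ i, st (i+1) ⊆ st i := by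
    intro i x hx
    rw [st_succ] at hx
    exact hN' i _ (key i).1 (key i).2 hx.1
  have hanti : Antitone st := antitone_nat_of_succ_le hsub
  have hjm : ∀ i, j i (st i) ∈ st i := fun i => hj i _ (key i).1 (key i).2
  refine ⟨fun i => j i (st i), fun i => N' i (st i), ?_, fun i => (key i).1 (hjm i),
    fun i => hR i _ (key i).1 (key i).2, ?_⟩
  · refine strictMono_nat_of_lt_succ fun i => ?_
    have := hjm (i+1)
    nth_rewrite 2 [st_succ] at this
    exact this.2
  · intro i k hik
    have := hanti (Nat.succ_le_of_lt hik) (hjm k)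
    rw [Nat.succ_eq_add_one, st_succ] at this
    exact this.1

/-- The pairs `(A n, B n)`, `n ∈ N`, converge on `C`. -/
def ConvOn {S : Type*} (A B : ℕ → Set S) (N : Set ℕ) (C : Set S) : Prop :=
  ∀ x ∈ C, {n ∈ N | x ∈ A n}.Finite ∨ {n ∈ N | x ∈ B n}.Finite

/-- No infinite subset of `N` gives convergence on `C`. -/
def BadOn {S : Type*} (A B : ℕ → Set S) (N : Set ℕ) (C : Set S) : Prop :=
  ∀ N' ⊆ N, N'.Infinite → ¬ ConvOn A B N' C

theorem ConvOn.almost {S : Type*} {A B : ℕ → Set S} {N N' : Set ℕ} {C : Set S}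
    (h : ConvOn A B N C) (hd : (N' \ N).Finite) : ConvOn A B N' C := by
  intro x hx
  refine (h x hx).imp (fun h => (h.union hd).subset ?_) (fun h => (h.union hd).subset ?_)
  all_goals
    rintro n ⟨hn, hn'⟩
    by_cases hnN : n ∈ N
    · exact Or.inl ⟨hnN, hn'⟩
    · exact Or.inr ⟨hn, hnN⟩

theorem BadOn.mono {S : Type*} {A B : ℕ → Set S} {N N' : Set ℕ} {C : Set S}
    (h : BadOn A B N C) (hd : N' ⊆ N) : BadOn A B N' C :=
  fun M hM => h M (hM.trans hd)

theorem range_diff_finite (l : ℕ → ℕ) (I : Set ℕ) (M : Set ℕ) (i : ℕ)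
    (h : ∀ k, i < k → l k ∈ M) : (l '' I \ M).Finite := by
  refine ((Set.finite_Iic i).image l).subset ?_
  rintro _ ⟨⟨k, -, rfl⟩, hk⟩
  refine ⟨k, ?_, rfl⟩
  by_contra hc
  exact hk (h k (by simpa using hc))

theorem rosenthal_step {S : Type*} (A B : ℕ → Set S) (N : Set ℕ) (hN : N.Infinite)
    (𝒞 : Set (Set S)) (hf : 𝒞.Finite) (hb : ∀ C ∈ 𝒞, BadOn A B N C) :
    ∃ j ∈ N, ∃ N' ⊆ N, N'.Infinite ∧
      ∀ C ∈ 𝒞, BadOn A B N' (C ∩ A j) ∧ BadOn A B N' (C ∩ B j) := by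
  by_contra hcon
  push Not at hcon
  have h1 : ∀ (i : ℕ) (M : Set ℕ), M ⊆ N → M.Infinite → ∃ j ∈ M, ∃ N' ⊆ M, N'.Infinite ∧
      ∃ C ∈ 𝒞, ∃ t : Bool, ConvOn A B N' (C ∩ (if t then A j else B j)) := by
    intro i M hM hMi
    obtain ⟨j, hj⟩ := hMi.nonempty
    obtain ⟨C, hC, hC'⟩ := hcon j (hM hj) M hM hMi
    by_cases hA : BadOn A B M (C ∩ A j)
    · have := hC' hA
      unfold BadOn at this
      push Not at this
      obtain ⟨N', h1, h2, h3⟩ := this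
      exact ⟨j, hj, N', h1, h2, C, hC, false, by simpa using h3⟩
    · unfold BadOn at hA
      push Not at hA
      obtain ⟨N', h1, h2, h3⟩ := hA
      exact ⟨j, hj, N', h1, h2, C, hC, true, by simpa using h3⟩
  obtain ⟨l, M, hl, hlN, hR, hlM⟩ := diag_aux _ N hN h1
  choose C hC t ht using hR
  have : Finite 𝒞 := hf
  obtain ⟨⟨⟨C0, hC0⟩, t0⟩, hinf⟩ := Finite.exists_infinite_fiber
    (fun i => ((⟨C i, hC i⟩ : 𝒞), t i))
  rw [Set.infinite_coe_iff] at hinf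
  set I := (fun i => ((⟨C i, hC i⟩ : 𝒞), t i)) ⁻¹' {(⟨C0, hC0⟩, t0)} with hI
  have hIm : ∀ i ∈ I, C i = C0 ∧ t i = t0 := by
    intro i hi
    simpa [hI] using hi
  have hPc : ∀ i ∈ I, ConvOn A B (l '' I) (C0 ∩ (if t0 then A (l i) else B (l i))) := by
    intro i hi
    have := (ht i).almost (range_diff_finite l I (M i) i (hlM i))
    rwa [(hIm i hi).1, (hIm i hi).2] at this
  refine hb C0 hC0 (l '' I) ?_ (hinf.image hl.injective.injOn) ?_
  · rintro _ ⟨i, -, rfl⟩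
    exact hlN i
  · intro x hx
    by_cases hex : ∃ i ∈ I, x ∈ (if t0 then A (l i) else B (l i))
    · obtain ⟨i, hi, hxi⟩ := hex
      exact hPc i hi x ⟨hx, hxi⟩
    · push Not at hex
      cases t0
      · right
        convert Set.finite_empty
        ext n
        simp only [Set.mem_ofPred_eq, Set.mem_empty_iff_false, iff_false]
        rintro ⟨⟨i, hi, rfl⟩, hx'⟩
        exact hex i hi (by simpa using hx')
      · left
        convert Set.finite_empty
        ext n
        simp only [Set.mem_ofPred_eq, Set.mem_empty_iff_false, iff_false]
        rintro ⟨⟨i, hi, rfl⟩, hx'⟩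
        exact hex i hi (by simpa using hx')

theorem rosenthal_indep {S : Type*} (A B : ℕ → Set S) (N : Set ℕ) (hN : N.Infinite)
    (hb : BadOn A B N Set.univ) :
    ∃ l : ℕ → ℕ, ∀ (m : ℕ) (t : Finset ℕ), ∃ x : S, ∀ i < m,
      (i ∈ t → x ∈ A (l i)) ∧ (i ∉ t → x ∈ B (l i)) := by
  let St := {p : Set ℕ × Set (Set S) // p.1.Infinite ∧ p.2.Finite ∧ ∀ C ∈ p.2, BadOn A B p.1 C}
  have step : ∀ p : St, ∃ (j : ℕ) (q : St), ∀ C ∈ p.1.2, C ∩ A j ∈ q.1.2 ∧ C ∩ B j ∈ q.1.2 := by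
    rintro ⟨⟨M, 𝒞⟩, h1, h2, h3⟩
    obtain ⟨j, hj, N', hN', hinf, h⟩ := rosenthal_step A B M h1 𝒞 h2 h3
    refine ⟨j, ⟨⟨N', (fun C => C ∩ A j) '' 𝒞 ∪ (fun C => C ∩ B j) '' 𝒞⟩, hinf,
      (h2.image _).union (h2.image _), ?_⟩, ?_⟩
    · rintro _ (⟨C, hC, rfl⟩ | ⟨C, hC, rfl⟩)
      · exact (h C hC).1
      · exact (h C hC).2
    · intro C hC
      exact ⟨Or.inl ⟨C, hC, rfl⟩, Or.inr ⟨C, hC, rfl⟩⟩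
  choose j q hq using step
  let s0 : St := ⟨⟨N, {Set.univ}⟩, hN, Set.finite_singleton _, by
    intro C hC
    rw [Set.mem_singleton_iff.1 hC]; exact hb⟩
  let st : ℕ → St := fun i => Nat.rec s0 (fun _ p => q p) i
  refine ⟨fun i => j (st i), fun m t => ?_⟩
  have key : ∀ m, ∃ C ∈ (st m).1.2, ∀ x ∈ C, ∀ i < m,
      (i ∈ t → x ∈ A (j (st i))) ∧ (i ∉ t → x ∈ B (j (st i))) := by
    intro m
    induction m with
    | zero => exact ⟨Set.univ, rfl, by simp⟩
    | succ m ih =>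
      obtain ⟨C, hC, hC'⟩ := ih
      by_cases hm : m ∈ t
      · refine ⟨C ∩ A (j (st m)), (hq (st m) C hC).1, ?_⟩
        rintro x ⟨hx, hx'⟩ i hi
        rcases Nat.lt_succ_iff_lt_or_eq.1 hi with hi | rfl
        · exact hC' x hx i hi
        · exact ⟨fun _ => hx', fun h => absurd hm h⟩
      · refine ⟨C ∩ B (j (st m)), (hq (st m) C hC).2, ?_⟩
        rintro x ⟨hx, hx'⟩ i hi
        rcases Nat.lt_succ_iff_lt_or_eq.1 hi with hi | rfl
        · exact hC' x hx i hi
        · exact ⟨fun h => absurd h hm, fun _ => hx'⟩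
  obtain ⟨C, hC, hC'⟩ := key m
  have hbad := (st m).2.2.2 C hC
  have hne : C.Nonempty := by
    by_contra hne
    rw [Set.not_nonempty_iff_eq_empty] at hne
    refine hbad _ subset_rfl (st m).2.1 ?_
    rw [hne]
    intro x hx
    exact hx.elim
  obtain ⟨x, hx⟩ := hne
  exact ⟨x, hC' x hx⟩

/-- The Rosenthal dichotomy for pointwise bounded sequences of real functions. -/
theorem rosenthal_dichotomy {S : Type*} (f : ℕ → S → ℝ) (hbd : ∀ s, ∃ c, ∀ n, |f n s| ≤ c) :
    (∃ l : ℕ → ℕ, StrictMono l ∧ ∀ s, ∃ c, Tendsto (fun n => f (l n) s) atTop (𝓝 c)) ∨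
    (∃ (a b : ℝ), a < b ∧ ∃ l : ℕ → ℕ, ∀ (m : ℕ) (t : Finset ℕ), ∃ s : S, ∀ i < m,
      (i ∈ t → b ≤ f (l i) s) ∧ (i ∉ t → f (l i) s ≤ a)) := by
  by_cases hc : ∃ (a b : ℚ), a < b ∧ ∃ N : Set ℕ, N.Infinite ∧
      BadOn (fun n => {s | (b:ℝ) ≤ f n s}) (fun n => {s | f n s ≤ (a:ℝ)}) N Set.univ
  · right
    obtain ⟨a, b, hab, N, hN, hb⟩ := hc
    obtain ⟨l, hl⟩ := rosenthal_indep _ _ N hN hb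
    exact ⟨a, b, by exact_mod_cast hab, l, hl⟩
  · left
    push Not at hc
    obtain ⟨e, he⟩ := exists_surjective_nat (ℚ × ℚ)
    have h1 : ∀ (i : ℕ) (M : Set ℕ), M ⊆ Set.univ → M.Infinite → ∃ j ∈ M, ∃ N' ⊆ M, N'.Infinite ∧
        ((e i).1 < (e i).2 → ConvOn (fun n => {s | ((e i).2:ℝ) ≤ f n s})
          (fun n => {s | f n s ≤ ((e i).1:ℝ)}) N' Set.univ) := by
      intro i M _ hM
      obtain ⟨j, hj⟩ := hM.nonempty
      by_cases hlt : (e i).1 < (e i).2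
      · have := hc _ _ hlt M hM
        unfold BadOn at this
        push Not at this
        obtain ⟨N', h1, h2, h3⟩ := this
        exact ⟨j, hj, N', h1, h2, fun _ => h3⟩
      · exact ⟨j, hj, M, subset_rfl, hM, fun h => absurd h hlt⟩
    obtain ⟨l, M, hl, -, hR, hlM⟩ := diag_aux _ Set.univ Set.infinite_univ h1
    refine ⟨l, hl, fun s => ?_⟩
    obtain ⟨c, hcb⟩ := hbd s
    refine tendsto_of_no_upcrossings (s := Set.range ((↑) : ℚ → ℝ)) Rat.denseRange_cast ?_ ?_ ?_
    · rintro _ ⟨a, rfl⟩ _ ⟨b, rfl⟩ hab ⟨hfa, hfb⟩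
      obtain ⟨i, hi⟩ := he (a, b)
      have h2 := hR i
      rw [hi] at h2
      have h3 := (h2 (by exact_mod_cast hab)).almost
        (range_diff_finite l Set.univ (M i) i (hlM i))
      have aux : ∀ p : ℕ → Prop, {n ∈ l '' Set.univ | p n}.Finite → ∀ᶠ n in atTop, ¬ p (l n) := by
        intro p hp
        have := (hp.preimage hl.injective.injOn)
        rw [← Nat.cofinite_eq_atTop, Filter.eventually_cofinite]
        refine this.subset ?_
        intro n hn
        exact ⟨⟨n, trivial, rfl⟩, by simpa using hn⟩
      rcases h3 s trivial with h | h
      · exact hfb ((aux _ h).mono fun n hn hn' => hn (le_of_lt hn'))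
      · exact hfa ((aux _ h).mono fun n hn hn' => hn (le_of_lt hn'))
    · exact isBoundedUnder_of ⟨c, fun n => (abs_le.1 (hcb _)).2⟩
    · exact isBoundedUnder_of ⟨-c, fun n => (abs_le.1 (hcb _)).1⟩

/-! ### Rademacher averages -/

/-- Rademacher sign. -/
def rsg (n : ℕ) (t : Finset ℕ) : ℝ := if n ∈ t then 1 else -1

theorem rsg_sq (n : ℕ) (t : Finset ℕ) : rsg n t * rsg n t = 1 := by
  unfold rsg; split_ifs <;> norm_num

theorem rsg_abs (n : ℕ) (t : Finset ℕ) : |rsg n t| = 1 := by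
  unfold rsg; split_ifs <;> norm_num

theorem rsg_flip (n : ℕ) (t : Finset ℕ) : rsg n (symmDiff t {n}) = - rsg n t := by
  unfold rsg
  by_cases h : n ∈ t <;> simp [Finset.mem_symmDiff, h]

theorem rsg_flip_ne {n k : ℕ} (hk : k ≠ n) (t : Finset ℕ) :
    rsg k (symmDiff t {n}) = rsg k t := by
  unfold rsg
  by_cases h : k ∈ t <;> simp [Finset.mem_symmDiff, h, hk]

theorem sum_flip {m n : ℕ} (hn : n < m) (F : Finset ℕ → ℝ)
    (hF : ∀ t, F (symmDiff t {n}) = - F t) :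
    ∑ t ∈ (Finset.range m).powerset, F t = 0 := by
  have h : ∑ t ∈ (Finset.range m).powerset, F t =
      ∑ t ∈ (Finset.range m).powerset, F (symmDiff t {n}) := by
    have hmem : ∀ t ∈ (Finset.range m).powerset, symmDiff t {n} ∈ (Finset.range m).powerset := by
      intro t ht
      rw [Finset.mem_powerset] at ht ⊢
      intro x hx
      rw [Finset.mem_symmDiff] at hx
      rcases hx with hx | hx
      · exact ht hx.1
      · rw [Finset.mem_singleton.1 hx.1]; exact Finset.mem_range.2 hn
    refine Finset.sum_nbij' (fun t => symmDiff t {n}) (fun t => symmDiff t {n}) hmem hmem ?_ ?_ ?_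
    · intro t _; simp
    · intro t _; simp
    · intro t _; simp
  simp only [hF, Finset.sum_neg_distrib] at h
  linarith

theorem rsg_sum_sq {m k : ℕ} (hk : k ≤ m) (a : ℕ → ℝ) :
    ∑ t ∈ (Finset.range m).powerset, (∑ n ∈ Finset.range k, a n * rsg n t) ^ 2 =
      2 ^ m * ∑ n ∈ Finset.range k, a n ^ 2 := by
  have h1 : ∀ t, (∑ n ∈ Finset.range k, a n * rsg n t) ^ 2 =
      ∑ n ∈ Finset.range k, ∑ n' ∈ Finset.range k, a n * a n' * (rsg n t * rsg n' t) := by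
    intro t
    rw [sq, Finset.sum_mul_sum]
    refine Finset.sum_congr rfl fun n _ => Finset.sum_congr rfl fun n' _ => by ring
  simp only [h1]
  rw [Finset.sum_comm, Finset.mul_sum]
  refine Finset.sum_congr rfl fun n hn => ?_
  rw [Finset.sum_comm, Finset.sum_eq_single n]
  · simp [rsg_sq]; ring
  · intro n' hn' hne
    rw [← Finset.mul_sum, sum_flip (n := n), mul_zero]
    · exact lt_of_lt_of_le (Finset.mem_range.1 hn) hk
    · intro t; rw [rsg_flip, rsg_flip_ne hne]; ring
  · intro h; exact absurd hn h

theorem rsg_avg_abs {m k : ℕ} (hk : k ≤ m) (a : ℕ → ℝ) :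
    ∑ t ∈ (Finset.range m).powerset, |∑ n ∈ Finset.range k, a n * rsg n t| ≤
      2 ^ m * √(∑ n ∈ Finset.range k, a n ^ 2) := by
  have h := sq_sum_le_card_mul_sum_sq (s := (Finset.range m).powerset)
    (f := fun t => |∑ n ∈ Finset.range k, a n * rsg n t|)
  simp only [sq_abs, rsg_sum_sq hk, Finset.card_powerset, Finset.card_range] at h
  refine abs_le_of_sq_le_sq' ?_ (by positivity) |>.2
  rw [mul_pow, Real.sq_sqrt (Finset.sum_nonneg fun _ _ => sq_nonneg _)]
  refine h.trans (le_of_eq ?_)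
  push_cast; ring

section
variable {X : Type*} [NormedAddCommGroup X] [NormedSpace ℝ X]

theorem exists_bad_functionals (x : ℕ → X) (a b : ℝ)
    (h : ∀ (m : ℕ) (t : Finset ℕ), ∃ φ : X →L[ℝ] ℝ, ‖φ‖ ≤ 1 ∧ ∀ i < m,
      (i ∈ t → b ≤ φ (x i)) ∧ (i ∉ t → φ (x i) ≤ a)) :
    ∃ g : ℕ → X →L[ℝ] ℝ, WeaklyNull g ∧ ∀ n, (b - a) / 2 ≤ g n (x n) := by
  choose φ hφ hφx using h
  let g0 : ℕ → ℕ → X →L[ℝ] ℝ := fun m n =>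
    ((2:ℝ)^m)⁻¹ • ∑ t ∈ (Finset.range m).powerset, rsg n t • φ m t
  have g0_apply : ∀ m n y, g0 m n y =
      ((2:ℝ)^m)⁻¹ * ∑ t ∈ (Finset.range m).powerset, rsg n t * φ m t y := by
    intro m n y
    simp [g0, sum_apply]
  have g0_norm : ∀ m n, ‖g0 m n‖ ≤ 1 := by
    intro m n
    have : ‖∑ t ∈ (Finset.range m).powerset, rsg n t • φ m t‖ ≤ 2 ^ m := by
      refine (norm_sum_le_of_le (n := fun _ => 1) _ ?_).trans ?_
      · intro t _
        rw [norm_smul, Real.norm_eq_abs, rsg_abs, one_mul]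
        exact hφ m t
      · simp
    simp only [g0, norm_smul, norm_inv, norm_pow, Real.norm_ofNat]
    rw [inv_mul_le_iff₀ (by positivity)]
    simpa using this
  let U : Ultrafilter ℕ := hyperfilter ℕ
  have hU : (U : Filter ℕ) ≤ atTop := Nat.hyperfilter_le_atTop
  have hlim : ∀ n, ∃ G : X →L[ℝ] ℝ, ∀ y, Tendsto (fun m => g0 m n y) U (𝓝 (G y)) := by
    intro n
    have hc := WeakDual.isCompact_closedBall (0 : StrongDual ℝ X) 1
    obtain ⟨G, -, hG⟩ := hc.ultrafilter_le_nhds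
      (U.map (fun m => StrongDual.toWeakDual (g0 m n))) (by
        rw [le_principal_iff]
        refine Filter.mem_map.2 (Filter.mem_of_superset Filter.univ_mem fun m _ => ?_)
        simpa using g0_norm m n)
    refine ⟨WeakDual.toStrongDual G, fun y => ?_⟩
    have : Tendsto (fun m => StrongDual.toWeakDual (g0 m n)) U (𝓝 G) := hG
    exact ((WeakDual.eval_continuous y).tendsto G).comp this
  choose G hG using hlim
  have hbound : ∀ (k : ℕ) (c : ℕ → ℝ),
      ‖∑ n ∈ Finset.range k, c n • G n‖ ≤ √(∑ n ∈ Finset.range k, c n ^ 2) := by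
    intro k c
    refine ContinuousLinearMap.opNorm_le_bound _ (Real.sqrt_nonneg _) fun y => ?_
    have ht : Tendsto (fun m => ‖∑ n ∈ Finset.range k, c n * g0 m n y‖) U
        (𝓝 ‖(∑ n ∈ Finset.range k, c n • G n) y‖) := by
      have : (∑ n ∈ Finset.range k, c n • G n) y = ∑ n ∈ Finset.range k, c n * G n y := by
        simp [sum_apply]
      rw [this]
      exact (tendsto_finsetSum _ fun n _ => (hG n y).const_mul (c n)).norm
    refine le_of_tendsto ht ?_
    filter_upwards [hU (eventually_ge_atTop k)] with m hm
    have e : ∑ n ∈ Finset.range k, c n * g0 m n y = ((2:ℝ)^m)⁻¹ *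
        ∑ t ∈ (Finset.range m).powerset, (∑ n ∈ Finset.range k, c n * rsg n t) * φ m t y := by
      simp only [g0_apply, Finset.sum_mul, Finset.mul_sum]
      rw [Finset.sum_comm]
      refine Finset.sum_congr rfl fun n _ => Finset.sum_congr rfl fun n' _ => by ring
    rw [e, norm_mul, norm_inv, norm_pow, Real.norm_ofNat, inv_mul_le_iff₀ (by positivity),
      ← mul_assoc]
    refine le_trans ?_ (mul_le_mul_of_nonneg_right (rsg_avg_abs hm c) (norm_nonneg y))
    rw [Finset.sum_mul]
    refine norm_sum_le_of_le _ fun t _ => ?_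
    rw [norm_mul, Real.norm_eq_abs]
    gcongr
    exact ((φ m t).le_opNorm y).trans (mul_le_of_le_one_left (norm_nonneg _) (hφ m t))
  refine ⟨G, ?_, ?_⟩
  · intro F
    have hs : Summable (fun n => (F (G n)) ^ 2) := by
      refine summable_of_sum_range_le (c := ‖F‖ ^ 2) (fun _ => sq_nonneg _) fun k => ?_
      set Sg := ∑ n ∈ Finset.range k, F (G n) ^ 2 with hS
      have h0 : 0 ≤ Sg := Finset.sum_nonneg fun _ _ => sq_nonneg _
      have h1 : Sg = F (∑ n ∈ Finset.range k, F (G n) • G n) := by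
        simp [hS, sq]
      have h2 : Sg ≤ ‖F‖ * √Sg := by
        calc Sg ≤ ‖F (∑ n ∈ Finset.range k, F (G n) • G n)‖ := by
              rw [← h1]; exact le_abs_self _
          _ ≤ ‖F‖ * ‖∑ n ∈ Finset.range k, F (G n) • G n‖ := F.le_opNorm _
          _ ≤ _ := by gcongr; exact hbound k _
      have h3 := Real.sq_sqrt h0
      nlinarith [Real.sqrt_nonneg Sg, norm_nonneg F, sq_nonneg (√Sg - ‖F‖)]
    have := hs.tendsto_atTop_zero
    have h2 := this.sqrt
    simp only [Real.sqrt_sq_eq_abs, Real.sqrt_zero] at h2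
    exact (tendsto_zero_iff_abs_tendsto_zero _).2 h2
  · intro n
    refine ge_of_tendsto (hG n (x n)) ?_
    filter_upwards [hU (eventually_gt_atTop n)] with m hm
    rw [g0_apply, le_inv_mul_iff₀ (by positivity)]
    have hz : ∑ t ∈ (Finset.range m).powerset, rsg n t = 0 :=
      sum_flip hm _ fun t => rsg_flip n t
    calc (2:ℝ) ^ m * ((b - a) / 2) = ∑ t ∈ (Finset.range m).powerset,
          ((b - a) / 2 + rsg n t * ((b + a) / 2)) := by
          rw [Finset.sum_add_distrib, ← Finset.sum_mul, hz]
          simp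
      _ ≤ _ := by
        refine Finset.sum_le_sum fun t _ => ?_
        by_cases hnt : n ∈ t
        · have := (hφx m t n hm).1 hnt
          simp only [rsg, hnt, if_true]; linarith
        · have := (hφx m t n hm).2 hnt
          simp only [rsg, hnt, if_false]; linarith

theorem dp_bddAbove {A : Set X} (hA : Bornology.IsBounded A) (f : X →L[ℝ] ℝ) :
    BddAbove (Set.range fun x : A => |f (x : X)|) := by
  obtain ⟨C, hC⟩ := hA.exists_norm_le
  refine ⟨‖f‖ * C, ?_⟩
  rintro _ ⟨x, rfl⟩
  exact (f.le_opNorm x).trans (mul_le_mul_of_nonneg_left (hC x x.2) (norm_nonneg _))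

theorem isDPSet_iff {A : Set X} : IsDPSet A ↔ Bornology.IsBounded A ∧
    ∀ f : ℕ → X →L[ℝ] ℝ, WeaklyNull f → ∀ ε > 0, ∀ᶠ n in atTop, ∀ x ∈ A, |f n x| ≤ ε := by
  refine and_congr_right fun hA => forall_congr' fun f => imp_congr_right fun _ => ?_
  constructor
  · intro h ε hε
    filter_upwards [h.eventually (gt_mem_nhds hε)] with n hn x hx
    exact (le_ciSup (dp_bddAbove hA (f n)) ⟨x, hx⟩).trans hn.le
  · intro h
    rw [Metric.tendsto_atTop']
    intro ε hε
    obtain ⟨N, hN⟩ := eventually_atTop.1 (h (ε / 2) (by positivity))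
    refine ⟨N, fun n hn => ?_⟩
    rw [Real.dist_0_eq_abs, abs_of_nonneg (Real.iSup_nonneg fun _ => abs_nonneg _)]
    have := Real.iSup_le (fun x : A => hN n hn.le x x.2) (by positivity)
    linarith

theorem dp_weakly_cauchy (x : ℕ → X) (hx : IsDPSet (Set.range x)) :
    ∃ l : ℕ → ℕ, StrictMono l ∧
      ∀ φ : X →L[ℝ] ℝ, ∃ c, Tendsto (fun n => φ (x (l n))) atTop (𝓝 c) := by
  obtain ⟨hbd, hdp⟩ := isDPSet_iff.1 hx
  obtain ⟨C, hC⟩ := hbd.exists_norm_le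
  rcases rosenthal_dichotomy (S := {φ : X →L[ℝ] ℝ // ‖φ‖ ≤ 1}) (fun n φ => φ.1 (x n)) (by
    intro φ
    refine ⟨‖φ.1‖ * C, fun n => ?_⟩
    exact (φ.1.le_opNorm _).trans
      (mul_le_mul_of_nonneg_left (hC _ ⟨n, rfl⟩) (norm_nonneg _))) with h | h
  · obtain ⟨l, hl, h⟩ := h
    refine ⟨l, hl, fun φ => ?_⟩
    have hp : 0 < ‖φ‖ + 1 := by positivity
    obtain ⟨c, hc⟩ := h ⟨(‖φ‖ + 1)⁻¹ • φ, by
      rw [norm_smul, norm_inv, Real.norm_of_nonneg hp.le, inv_mul_le_iff₀ hp]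
      linarith⟩
    refine ⟨(‖φ‖ + 1) * c, ?_⟩
    refine (hc.const_mul (‖φ‖ + 1)).congr fun n => ?_
    simp only [smul_apply, smul_eq_mul]
    field_simp
  · exfalso
    obtain ⟨a, b, hab, l, h⟩ := h
    obtain ⟨g, hg, hg'⟩ := exists_bad_functionals (fun i => x (l i)) a b (by
      intro m t
      obtain ⟨φ, hφ⟩ := h m t
      exact ⟨φ.1, φ.2, hφ⟩)
    obtain ⟨n, hn⟩ := (hdp g hg ((b - a) / 4) (by linarith)).exists
    have h1 := (le_abs_self _).trans (hn _ ⟨l n, rfl⟩)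
    have h2 := hg' n
    linarith

theorem dp_cauchy_subseq
    (H : ∀ x : ℕ → X, WeaklyNull x → IsDPSet (Set.range x) →
        Tendsto (fun n => ‖x n‖) atTop (𝓝 0))
    (x : ℕ → X) (hx : IsDPSet (Set.range x)) :
    ∃ l : ℕ → ℕ, StrictMono l ∧ CauchySeq (x ∘ l) := by
  obtain ⟨l, hl, hw⟩ := dp_weakly_cauchy x hx
  obtain ⟨hbd, hdp⟩ := isDPSet_iff.1 hx
  refine ⟨l, hl, ?_⟩
  by_contra hcon
  rw [Metric.cauchySeq_iff] at hcon
  push Not at hcon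
  obtain ⟨ε, hε, h⟩ := hcon
  choose p hp q hq hpq using h
  have hpt : Tendsto p atTop atTop := tendsto_atTop_mono hp tendsto_id
  have hqt : Tendsto q atTop atTop := tendsto_atTop_mono hq tendsto_id
  have := H (fun n => x (l (p n)) - x (l (q n))) ?_ ?_
  · obtain ⟨n, hn⟩ := (this.eventually (gt_mem_nhds hε)).exists
    have h2 := hpq n
    rw [dist_eq_norm] at h2
    exact absurd hn (not_lt.2 h2)
  · intro φ
    obtain ⟨c, hc⟩ := hw φ
    have h3 := (hc.comp hpt).sub (hc.comp hqt)
    rw [sub_self] at h3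
    refine h3.congr fun n => ?_
    simp
  · rw [isDPSet_iff]
    constructor
    · obtain ⟨C, hC⟩ := hbd.exists_norm_le
      rw [isBounded_iff_forall_norm_le]
      refine ⟨C + C, ?_⟩
      rintro _ ⟨n, rfl⟩
      exact (norm_sub_le _ _).trans (add_le_add (hC _ ⟨_, rfl⟩) (hC _ ⟨_, rfl⟩))
    · intro f hf ε hε
      filter_upwards [hdp f hf (ε / 2) (by positivity)] with n hn
      rintro _ ⟨k, rfl⟩
      rw [map_sub]
      have h1 := hn _ ⟨l (p k), rfl⟩
      have h2 := hn _ ⟨l (q k), rfl⟩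
      have h3 := abs_sub (f n (x (l (p k)))) (f n (x (l (q k))))
      linarith

end

theorem stmt5 {X : Type*} [NormedAddCommGroup X] [NormedSpace ℝ X] [CompleteSpace X] :
    HasDPrcP X ↔
      ∀ x : ℕ → X, WeaklyNull x → IsDPSet (Set.range x) →
        Tendsto (fun n => ‖x n‖) atTop (𝓝 0) := by
  constructor
  · intro H x hx hdp
    have hc := H _ hdp
    refine tendsto_of_subseq_tendsto fun ns hns => ?_
    obtain ⟨y, -, k, hk, hy⟩ := hc.tendsto_subseq (x := fun n => x (ns n))
      (fun n => subset_closure ⟨ns n, rfl⟩)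
    refine ⟨k, ?_⟩
    have hy0 : y = 0 := by
      rw [NormedSpace.eq_zero_iff_forall_dual_eq_zero ℝ]
      intro φ
      have h1 := (φ.continuous.tendsto y).comp hy
      have h2 := (hx φ).comp (hns.comp hk.tendsto_atTop)
      exact tendsto_nhds_unique h1 h2
    subst hy0
    have := hy.norm
    rw [norm_zero] at this
    exact this
  · intro H A hA
    refine IsSeqCompact.isCompact ?_
    intro y hy
    have hex : ∀ n : ℕ, ∃ z ∈ A, dist (y n) z < 1 / ((n : ℝ) + 1) := fun n =>
      Metric.mem_closure_iff.1 (hy n) _ Nat.one_div_pos_of_nat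
    choose z hz hyz using hex
    have hsub : Set.range z ⊆ A := by
      rintro _ ⟨n, rfl⟩
      exact hz n
    have hzdp : IsDPSet (Set.range z) := by
      rw [isDPSet_iff] at hA ⊢
      exact ⟨hA.1.subset hsub, fun f hf ε hε =>
        (hA.2 f hf ε hε).mono fun n hn x hx => hn x (hsub hx)⟩
    obtain ⟨l, hl, hc⟩ := dp_cauchy_subseq H z hzdp
    obtain ⟨a, ha⟩ := cauchySeq_tendsto_of_complete hc
    have hd : Tendsto (fun n => dist (y n) (z n)) atTop (𝓝 0) :=
      squeeze_zero (fun _ => dist_nonneg) (fun n => (hyz n).le)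
        tendsto_one_div_add_atTop_nhds_zero_nat
    have hya : Tendsto (y ∘ l) atTop (𝓝 a) := by
      refine (tendsto_iff_of_dist ?_).2 ha
      exact hd.comp hl.tendsto_atTop
    exact ⟨a, isClosed_closure.mem_of_tendsto hya (Eventually.of_forall fun n => hy _), l, hl, hya⟩
end
end

section
/- A Banach space X has the relatively compact Dunford-Pettis property if and only if every norm bounded subset of X' is an L-Dunford-Pettis set. -/
open Filter Topology Metric

noncomputable section

def osc {S : Type*} (A B : ℕ → Set S) (M : Set ℕ) (s : S) : Prop :=
  {n ∈ M | s ∈ A n}.Infinite ∧ {n ∈ M | s ∈ B n}.Infinite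

theorem osc.mono' {S : Type*} {A B : ℕ → Set S} {M M' : Set ℕ} {s : S} (h : osc A B M s)
    (hM : (M \ M').Finite) : osc A B M' s := by
  constructor
  · intro hf
    apply h.1
    refine (hf.union hM).subset ?_
    rintro n ⟨h1, h2⟩
    by_cases hn : n ∈ M'
    · exact Or.inl ⟨hn, h2⟩
    · exact Or.inr ⟨h1, hn⟩
  · intro hf
    apply h.2
    refine (hf.union hM).subset ?_
    rintro n ⟨h1, h2⟩
    by_cases hn : n ∈ M'
    · exact Or.inl ⟨hn, h2⟩
    · exact Or.inr ⟨h1, hn⟩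

def good {S : Type*} (A B : ℕ → Set S) (T : Set S) (M : Set ℕ) : Prop :=
  ∀ M' ⊆ M, M'.Infinite → ∃ s ∈ T, osc A B M' s

theorem diag (Q : ℕ → ℕ → Set ℕ → Prop) (hQ : ∀ j m M M', M' ⊆ M → Q j m M → Q j m M')
    (M0 : Set ℕ) (hM0 : M0.Infinite)
    (h : ∀ j, ∀ M ⊆ M0, M.Infinite → ∃ m ∈ M, ∃ M' ⊆ M, M'.Infinite ∧ Q j m M') :
    ∃ m : ℕ → ℕ, StrictMono m ∧ (∀ j, m j ∈ M0) ∧ ∀ j, Q j (m j) (m '' Set.Ioi j) := by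
  have h2 : ∀ (j : ℕ) (M : {M : Set ℕ // M ⊆ M0 ∧ M.Infinite}), ∃ (m : ℕ) (M' : {M : Set ℕ // M ⊆ M0 ∧ M.Infinite}),
      m ∈ M.1 ∧ M'.1 ⊆ M.1 ∧ (∀ k ∈ M'.1, m < k) ∧ Q j m M'.1 := by
    rintro j ⟨M, hM, hMi⟩
    obtain ⟨m, hm, M', hM', hi, hq⟩ := h j M hM hMi
    refine ⟨m, ⟨M' \ Set.Iic m, (Set.sdiff_subset.trans hM').trans hM, hi.sdiff (Set.finite_Iic m)⟩, hm,
      Set.sdiff_subset.trans hM', ?_, hQ _ _ _ _ Set.sdiff_subset hq⟩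
    rintro k ⟨_, hk⟩
    simpa using hk
  choose m N h1 h2 h3 h4 using h2
  let st : ℕ → {M : Set ℕ // M ⊆ M0 ∧ M.Infinite} :=
    fun n => Nat.rec ⟨M0, subset_rfl, hM0⟩ (fun j M => N j M) n
  have hst : ∀ n, st (n+1) = N n (st n) := fun n => rfl
  have hanti : Antitone (fun n => (st n).1) := antitone_nat_of_succ_le fun n => by
    rw [hst]; exact h2 _ _
  have hmem : ∀ j i, j < i → m i (st i) ∈ (st (j+1)).1 := fun j i hij =>
    hanti (show j + 1 ≤ i from hij) (h1 _ _)
  refine ⟨fun n => m n (st n), ?_, fun j => (st j).2.1 (h1 _ _), fun j => ?_⟩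
  · intro j i hij
    exact h3 j (st j) _ (hmem j i hij)
  · refine hQ _ _ _ _ ?_ (h4 j (st j))
    rintro _ ⟨i, hi, rfl⟩
    exact hmem j i hi

theorem step {S : Type*} (A B : ℕ → Set S) (ι : Type*) [Finite ι] (T : ι → Set S) (M : Set ℕ)
    (hM : M.Infinite) (hT : ∀ i, good A B (T i) M) :
    ∃ m ∈ M, ∃ M' ⊆ M, M'.Infinite ∧ ∀ i, good A B (T i ∩ A m) M' ∧ good A B (T i ∩ B m) M' := by
  by_contra hcon
  push Not at hcon
  let C : Bool → ℕ → Set S := fun b => if b then A else B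
  obtain ⟨m, hm, hmM, hq⟩ := diag
    (fun _ m M' => ∃ p : ι × Bool, ∀ s ∈ T p.1 ∩ C p.2 m, ¬ osc A B M' s)
    (by
      rintro _ m M M' hMM ⟨p, hp⟩
      refine ⟨p, fun s hs ho => hp s hs (ho.mono' ?_)⟩
      rw [Set.sdiff_eq_empty.2 hMM]; exact Set.finite_empty) M hM
    (by
      intro _ N hN hNi
      obtain ⟨m, hmN⟩ := hNi.nonempty
      obtain ⟨i, hi⟩ := hcon m (hN hmN) N hN hNi
      have : ∃ b, ¬ good A B (T i ∩ C b m) N := by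
        by_cases hg : good A B (T i ∩ A m) N
        · exact ⟨false, by simpa [C] using hi hg⟩
        · exact ⟨true, by simpa [C] using hg⟩
      obtain ⟨b, hb⟩ := this
      unfold good at hb
      push Not at hb
      obtain ⟨M', h1, h2, h3⟩ := hb
      exact ⟨m, hmN, M', h1, h2, (i, b), h3⟩)
  choose p hp using hq
  obtain ⟨⟨i, b⟩, hib⟩ := Finite.exists_infinite_fiber p
  have hJ : (p ⁻¹' {(i, b)}).Infinite := Set.infinite_coe_iff.1 hib
  set J := p ⁻¹' {(i, b)} with hJd
  obtain ⟨s, hs, ho⟩ := hT i (m '' J) (by rintro _ ⟨j, _, rfl⟩; exact hmM j)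
    (hJ.image hm.injective.injOn)
  have : {n ∈ m '' J | s ∈ C b n}.Infinite := by
    cases b
    · exact ho.2
    · exact ho.1
  obtain ⟨_, ⟨j, hj, rfl⟩, hsj⟩ := this.nonempty
  have hpj : p j = (i, b) := hj
  refine hp j s (by rw [hpj]; exact ⟨hs, hsj⟩) (ho.mono' ?_)
  refine ((Set.finite_Iic j).image m).subset ?_
  rintro _ ⟨⟨k, hk, rfl⟩, h2⟩
  refine ⟨k, ?_, rfl⟩
  by_contra h3
  exact h2 ⟨k, by simpa using h3, rfl⟩

theorem indep {S : Type*} (A B : ℕ → Set S) (M : Set ℕ)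
    (hM : M.Infinite) (hT : good A B Set.univ M) :
    ∃ m : ℕ → ℕ, ∀ (N : ℕ) (E : Set ℕ), ∃ s : S, ∀ j < N,
      (j ∈ E → s ∈ A (m j)) ∧ (j ∉ E → s ∈ B (m j)) := by
  let St := {p : Set (Set S) × Set ℕ // p.1.Finite ∧ p.2.Infinite ∧ ∀ T ∈ p.1, good A B T p.2}
  have h : ∀ p : St, ∃ (m : ℕ) (p' : St), ∀ T ∈ p.1.1, T ∩ A m ∈ p'.1.1 ∧ T ∩ B m ∈ p'.1.1 := by
    rintro ⟨⟨F, M⟩, hF, hM, hg⟩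
    have : Finite F := hF
    obtain ⟨m, hm, M', hM', hi, h2⟩ := step A B F (fun T => T.1) M hM (fun T => hg T.1 T.2)
    refine ⟨m, ⟨⟨(fun T => T ∩ A m) '' F ∪ (fun T => T ∩ B m) '' F, M'⟩,
      (hF.image _).union (hF.image _), hi, ?_⟩, ?_⟩
    · rintro _ (⟨T, hT, rfl⟩ | ⟨T, hT, rfl⟩)
      · exact (h2 ⟨T, hT⟩).1
      · exact (h2 ⟨T, hT⟩).2
    · intro T hT
      exact ⟨Or.inl ⟨T, hT, rfl⟩, Or.inr ⟨T, hT, rfl⟩⟩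
  choose m nx hnx using h
  let st : ℕ → St := fun n => Nat.rec
    ⟨⟨{Set.univ}, M⟩, Set.finite_singleton _, hM, by rintro _ rfl; exact hT⟩ (fun _ p => nx p) n
  refine ⟨fun n => m (st n), fun N E => ?_⟩
  have key : {s : S | ∀ j < N, (j ∈ E → s ∈ A (m (st j))) ∧ (j ∉ E → s ∈ B (m (st j)))}
      ∈ (st N).1.1 := by
    induction N with
    | zero => simp [st]
    | succ N ih =>
      have h3 := hnx (st N) _ ih
      by_cases hN : N ∈ E
      · convert h3.1 using 1
        ext s
        simp only [Set.mem_ofPred_eq, Set.mem_inter_iff, Nat.forall_lt_succ_right]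
        simp [hN]
      · convert h3.2 using 1
        ext s
        simp only [Set.mem_ofPred_eq, Set.mem_inter_iff, Nat.forall_lt_succ_right]
        simp [hN]
  obtain ⟨s, hs, _⟩ := (st N).2.2.2 _ key _ subset_rfl (st N).2.2.1
  exact ⟨s, hs⟩

/-- Rademacher-type sign. -/
def sg (E : Finset ℕ) (n : ℕ) : ℝ := if n ∈ E then 1 else -1

theorem sg_sq (E : Finset ℕ) (n : ℕ) : sg E n ^ 2 = 1 := by
  unfold sg; split_ifs <;> norm_num

theorem sum_sg_sq (a : ℕ → ℝ) (N : ℕ) :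
    ∑ E ∈ (Finset.range N).powerset, (∑ n ∈ Finset.range N, a n * sg E n) = 0 ∧
    ∑ E ∈ (Finset.range N).powerset, (∑ n ∈ Finset.range N, a n * sg E n) ^ 2
      = 2 ^ N * ∑ n ∈ Finset.range N, a n ^ 2 := by
  induction N with
  | zero => simp
  | succ N ih =>
    have e1 : ∀ E ∈ (Finset.range N).powerset,
        (∑ n ∈ Finset.range (N+1), a n * sg E n) = (∑ n ∈ Finset.range N, a n * sg E n) - a N := by
      intro E hE
      rw [Finset.sum_range_succ]
      have : N ∉ E := fun h => by simpa using Finset.mem_powerset.1 hE h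
      simp [sg, this]
      ring
    have e2 : ∀ E ∈ (Finset.range N).powerset,
        (∑ n ∈ Finset.range (N+1), a n * sg (insert N E) n)
          = (∑ n ∈ Finset.range N, a n * sg E n) + a N := by
      intro E hE
      rw [Finset.sum_range_succ]
      congr 1
      · refine Finset.sum_congr rfl fun n hn => ?_
        have : n ≠ N := by have := Finset.mem_range.1 hn; omega
        simp [sg, this]
      · simp [sg]
    constructor
    · rw [Finset.range_add_one, Finset.sum_powerset_insert (by simp), ← Finset.range_add_one,
        Finset.sum_congr rfl e1, Finset.sum_congr rfl e2, Finset.sum_sub_distrib,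
        Finset.sum_add_distrib, ih.1]
      ring
    · rw [Finset.range_add_one, Finset.sum_powerset_insert (by simp), ← Finset.range_add_one,
        ← Finset.sum_add_distrib,
        Finset.sum_congr rfl (fun E hE => show _ = 2 * (∑ n ∈ Finset.range N, a n * sg E n) ^ 2
          + 2 * a N ^ 2 by rw [e1 E hE, e2 E hE]; ring), Finset.sum_add_distrib, ← Finset.mul_sum, ih.2,
        Finset.sum_range_succ]
      simp
      ring

theorem sum_sg (N n : ℕ) (hn : n < N) : ∑ E ∈ (Finset.range N).powerset, sg E n = 0 := by
  have := (sum_sg_sq (fun k => if k = n then 1 else 0) N).1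
  simpa [hn] using this

section
variable {X : Type*} [NormedAddCommGroup X] [NormedSpace ℝ X]

theorem exists_weaklyNull (y : ℕ → X) (p q : ℝ) (hpq : p < q)
    (h : ∀ (N : ℕ) (E : Set ℕ), ∃ f : X →L[ℝ] ℝ, ‖f‖ ≤ 1 ∧ ∀ j < N,
      (j ∈ E → q ≤ f (y j)) ∧ (j ∉ E → f (y j) ≤ p)) :
    ∃ g : ℕ → X →L[ℝ] ℝ, WeaklyNull g ∧ ∀ n, (q - p) / 2 ≤ g n (y n) := by
  choose F hF1 hF2 using h
  let g : ℕ → ℕ → X →L[ℝ] ℝ := fun N n =>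
    ((2:ℝ)^N)⁻¹ • ∑ E ∈ (Finset.range N).powerset, sg E n • F N E
  have hgx : ∀ N n x, g N n x =
      ((2:ℝ)^N)⁻¹ * ∑ E ∈ (Finset.range N).powerset, sg E n * F N E x := by
    intro N n x
    simp [g, ContinuousLinearMap.sum_apply]
  have hFx : ∀ N (E : Finset ℕ) x, (F N E x)^2 ≤ ‖x‖^2 := by
    intro N E x
    rw [← sq_abs]
    gcongr
    simpa using (F N E).le_of_opNorm_le (hF1 N E) x
  -- upper estimate
  have hup : ∀ N (a : ℕ → ℝ) x, (∑ n ∈ Finset.range N, a n * g N n x)^2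
      ≤ (∑ n ∈ Finset.range N, a n ^ 2) * ‖x‖^2 := by
    intro N a x
    have e : ∑ n ∈ Finset.range N, a n * g N n x = ((2:ℝ)^N)⁻¹ *
        ∑ E ∈ (Finset.range N).powerset, (∑ n ∈ Finset.range N, a n * sg E n) * F N E x := by
      simp only [hgx, Finset.mul_sum, Finset.sum_mul]
      rw [Finset.sum_comm]
      refine Finset.sum_congr rfl fun E _ => Finset.sum_congr rfl fun n _ => ?_
      ring
    have cs := Finset.sum_mul_sq_le_sq_mul_sq (Finset.range N).powerset
      (fun E => ∑ n ∈ Finset.range N, a n * sg E n) (fun E => F N E x)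
    rw [(sum_sg_sq a N).2] at cs
    have h2 : ∑ E ∈ (Finset.range N).powerset, (F N E x)^2 ≤ 2^N * ‖x‖^2 := by
      refine (Finset.sum_le_sum fun E _ => hFx N E x).trans ?_
      simp
    rw [e, mul_pow]
    have hpos : (0:ℝ) < 2^N := by positivity
    have hS : 0 ≤ ∑ n ∈ Finset.range N, a n ^ 2 := Finset.sum_nonneg fun _ _ => sq_nonneg _
    calc _ ≤ (((2:ℝ)^N)⁻¹)^2 * (2 ^ N * (∑ n ∈ Finset.range N, a n ^ 2) * (2^N * ‖x‖^2)) := by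
          gcongr
          exact cs.trans (by gcongr)
      _ = _ := by field_simp
  have hup2 : ∀ N K, K ≤ N → ∀ (a : ℕ → ℝ) x, (∑ n ∈ Finset.range K, a n * g N n x)^2
      ≤ (∑ n ∈ Finset.range K, a n ^ 2) * ‖x‖^2 := by
    intro N K hK a x
    have := hup N (fun n => if n < K then a n else 0) x
    have e1 : ∀ G : ℕ → ℝ, (∀ n, ¬ n < K → G n = 0) →
        ∑ n ∈ Finset.range N, G n = ∑ n ∈ Finset.range K, G n := by
      intro G hG
      symm
      apply Finset.sum_subset
      · intro n; simp; omega
      · intro n _ h2; exact hG n (by simpa using h2)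
    rw [e1 _ (by intro n hn; simp [hn]), e1 _ (by intro n hn; simp [hn])] at this
    have c1 : ∑ n ∈ Finset.range K, (if n < K then a n else 0) * g N n x
        = ∑ n ∈ Finset.range K, a n * g N n x :=
      Finset.sum_congr rfl (fun n hn => by rw [if_pos (Finset.mem_range.1 hn)])
    have c2 : ∑ n ∈ Finset.range K, (if n < K then a n else 0) ^ 2
        = ∑ n ∈ Finset.range K, a n ^ 2 :=
      Finset.sum_congr rfl (fun n hn => by rw [if_pos (Finset.mem_range.1 hn)])
    rw [c1, c2] at this
    exact this
  have hlow : ∀ N n, n < N → (q - p)/2 ≤ g N n (y n) := by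
    intro N n hn
    rw [hgx]
    have : ∑ E ∈ (Finset.range N).powerset, ((q-p)/2 + sg E n * ((q+p)/2)) ≤
        ∑ E ∈ (Finset.range N).powerset, sg E n * F N E (y n) := by
      refine Finset.sum_le_sum fun E _ => ?_
      have := hF2 N E n hn
      unfold sg
      split_ifs with hE
      · have := this.1 hE
        linarith
      · have := this.2 hE
        linarith
    rw [Finset.sum_add_distrib, ← Finset.sum_mul, sum_sg N n hn] at this
    simp at this
    have hpos : (0:ℝ) < 2^N := by positivity
    rw [inv_mul_eq_div, le_div_iff₀ hpos]
    linarith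
  have hgn : ∀ N n, ‖g N n‖ ≤ 1 := by
    intro N n
    have hpos : (0:ℝ) < 2^N := by positivity
    have : ‖∑ E ∈ (Finset.range N).powerset, sg E n • F N E‖ ≤ 2^N := by
      refine (norm_sum_le _ _).trans ?_
      refine (Finset.sum_le_sum (g := fun _ => (1:ℝ)) fun E _ => ?_).trans (by simp)
      rw [norm_smul]
      have : ‖sg E n‖ = 1 := by unfold sg; split_ifs <;> simp
      rw [this, one_mul]
      exact hF1 N E
    simp only [g]
    rw [norm_smul, norm_inv, Real.norm_of_nonneg hpos.le, inv_mul_eq_div, div_le_one hpos]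
    exact this
  -- limit
  have hU : (hyperfilter ℕ : Filter ℕ) ≤ atTop := by
    rw [← Nat.cofinite_eq_atTop]; exact hyperfilter_le_cofinite
  have hlim : ∀ n, ∃ G : X →L[ℝ] ℝ, ∀ x, Tendsto (fun N => g N n x) (hyperfilter ℕ) (𝓝 (G x)) := by
    intro n
    obtain ⟨G, -, hG⟩ := (WeakDual.isCompact_closedBall (𝕜 := ℝ) (E := X) 0 1).ultrafilter_le_nhds
      ((hyperfilter ℕ).map (fun N => StrongDual.toWeakDual (g N n))) (by
        simp only [le_principal_iff]
        refine Filter.mem_map.2 (Filter.Eventually.of_forall fun N => ?_)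
        simpa using hgn N n)
    refine ⟨WeakDual.toStrongDual G, fun x => ?_⟩
    have h1 : Tendsto (fun N => StrongDual.toWeakDual (g N n)) (hyperfilter ℕ) (𝓝 G) := hG
    exact ((WeakDual.eval_continuous x).tendsto G).comp h1
  choose G hG using hlim
  have hGup : ∀ K (a : ℕ → ℝ) x, (∑ n ∈ Finset.range K, a n * G n x)^2
      ≤ (∑ n ∈ Finset.range K, a n ^ 2) * ‖x‖^2 := by
    intro K a x
    have ht : Tendsto (fun N => (∑ n ∈ Finset.range K, a n * g N n x)^2) (hyperfilter ℕ)
        (𝓝 ((∑ n ∈ Finset.range K, a n * G n x)^2)) :=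
      (tendsto_finsetSum _ fun n _ => (hG n x).const_mul (a n)).pow 2
    exact le_of_tendsto ht (hU ((eventually_ge_atTop K).mono fun N hN => hup2 N K hN a x))
  refine ⟨G, fun φ => ?_, fun n => ge_of_tendsto (hG n (y n))
    (hU ((eventually_gt_atTop n).mono fun N hN => hlow N n hN))⟩
  have hb : ∀ K, ∑ n ∈ Finset.range K, (φ (G n))^2 ≤ ‖φ‖^2 := by
    intro K
    set s := ∑ n ∈ Finset.range K, (φ (G n))^2 with hs
    have hs0 : 0 ≤ s := Finset.sum_nonneg fun _ _ => sq_nonneg _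
    have hn : ‖∑ n ∈ Finset.range K, φ (G n) • G n‖ ≤ √s := by
      refine ContinuousLinearMap.opNorm_le_bound _ (Real.sqrt_nonneg _) fun x => ?_
      refine abs_le_of_sq_le_sq ?_ (by positivity)
      rw [mul_pow, Real.sq_sqrt hs0]
      simpa [ContinuousLinearMap.sum_apply] using hGup K (fun n => φ (G n)) x
    have h1 : φ (∑ n ∈ Finset.range K, φ (G n) • G n) = s := by
      simp [hs, sq]
    have h2 : s ≤ ‖φ‖ * √s := by
      rw [← h1]
      refine (le_abs_self _).trans ((φ.le_opNorm _).trans ?_)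
      rw [h1]
      gcongr
    have h3 : √s * √s = s := Real.mul_self_sqrt hs0
    have h4 : 0 ≤ √s := Real.sqrt_nonneg _
    have h5 : √s ≤ ‖φ‖ := by
      by_contra hc
      push Not at hc
      nlinarith [norm_nonneg φ]
    nlinarith
  have hsum : Summable fun n => (φ (G n))^2 :=
    summable_of_sum_range_le (fun n => sq_nonneg _) hb
  have := hsum.tendsto_atTop_zero
  have h2 := this.sqrt
  simp only [Real.sqrt_sq_eq_abs, Real.sqrt_zero] at h2
  exact (tendsto_zero_iff_abs_tendsto_zero _).2 h2

theorem IsDPSet.bdd {A : Set X} (hA : IsDPSet A) (f : X →L[ℝ] ℝ) :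
    BddAbove (Set.range fun x : A => |f (x : X)|) := by
  obtain ⟨C, hC⟩ := hA.1.exists_norm_le
  refine ⟨‖f‖ * C, ?_⟩
  rintro _ ⟨x, rfl⟩
  exact (f.le_opNorm _).trans (by gcongr; exact hC _ x.2)

theorem IsDPSet.exists_wCauchy {A : Set X} (hA : IsDPSet A) (x : ℕ → X) (hx : ∀ n, x n ∈ A) :
    ∃ m : ℕ → ℕ, StrictMono m ∧ ∀ f : X →L[ℝ] ℝ, ∃ c, Tendsto (fun j => f (x (m j))) atTop (𝓝 c) := by
  obtain ⟨C, hC⟩ := hA.1.exists_norm_le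
  let S := {f : X →L[ℝ] ℝ // ‖f‖ ≤ 1}
  let P : ℚ → ℕ → Set S := fun a n => {f | f.1 (x n) < a}
  let R : ℚ → ℕ → Set S := fun b n => {f | b < f.1 (x n)}
  by_cases hgood : ∃ (a b : ℚ) (M : Set ℕ), a < b ∧ M.Infinite ∧ good (R b) (P a) Set.univ M
  · exfalso
    obtain ⟨a, b, M, hab, hM, hg⟩ := hgood
    obtain ⟨m, hm⟩ := indep _ _ M hM hg
    obtain ⟨g, hg0, hg1⟩ := exists_weaklyNull (fun j => x (m j)) a b (by exact_mod_cast hab)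
      (by
        intro N E
        obtain ⟨s, hs⟩ := hm N E
        exact ⟨s.1, s.2, fun j hj => ⟨fun h => le_of_lt ((hs j hj).1 h),
          fun h => le_of_lt ((hs j hj).2 h)⟩⟩)
    have ht := hA.2 g hg0
    have hge : ((b:ℝ) - a)/2 ≤ 0 := by
      refine ge_of_tendsto ht (Eventually.of_forall fun n => ?_)
      exact (hg1 n).trans ((le_abs_self _).trans (le_ciSup (hA.bdd (g n)) ⟨x (m n), hx _⟩))
    have : (a:ℝ) < b := by exact_mod_cast hab
    linarith
  · push Not at hgood
    obtain ⟨e, he⟩ := exists_surjective_nat (ℚ × ℚ)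
    obtain ⟨m, hm, -, hq⟩ := diag
      (fun j _ M => (e j).1 < (e j).2 → ∀ s, ¬ osc (R (e j).2) (P (e j).1) M s)
      (by
        intro j _ M M' hMM h hlt s ho
        refine h hlt s (ho.mono' ?_)
        rw [Set.sdiff_eq_empty.2 hMM]; exact Set.finite_empty) Set.univ Set.infinite_univ
      (by
        intro j M _ hM
        obtain ⟨k, hk⟩ := hM.nonempty
        by_cases hlt : (e j).1 < (e j).2
        · have := hgood _ _ M hlt hM
          unfold good at this
          push Not at this
          obtain ⟨M', h1, h2, h3⟩ := this
          exact ⟨k, hk, M', h1, h2, fun _ s => h3 s (Set.mem_univ _)⟩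
        · exact ⟨k, hk, M, subset_rfl, hM, fun h => absurd h hlt⟩)
    refine ⟨m, hm, ?_⟩
    have h1 : ∀ f : X →L[ℝ] ℝ, ‖f‖ ≤ 1 → ∃ c, Tendsto (fun j => f (x (m j))) atTop (𝓝 c) := by
      intro f hf
      have hfb : ∀ j, |f (x (m j))| ≤ C := fun j => by
        have := f.le_of_opNorm_le hf (x (m j))
        rw [one_mul] at this
        exact this.trans (hC _ (hx _))
      refine tendsto_of_no_upcrossings (s := Set.range ((↑) : ℚ → ℝ)) Rat.isDenseEmbedding_coe_real.dense ?_
        (isBoundedUnder_of ⟨C, fun j => (abs_le.1 (hfb j)).2⟩)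
        (isBoundedUnder_of ⟨-C, fun j => (abs_le.1 (hfb j)).1⟩)
      rintro _ ⟨a, rfl⟩ _ ⟨b, rfl⟩ hab ⟨ha, hb⟩
      obtain ⟨j, hj⟩ := he (a, b)
      have hqj := hq j
      rw [hj] at hqj
      have inf : ∀ Q : ℕ → Prop, (∃ᶠ i in atTop, Q (m i)) →
          {n ∈ m '' Set.Ioi j | Q n}.Infinite := by
        intro Q hQ
        have h3 := hQ.and_eventually (eventually_gt_atTop j)
        rw [Nat.frequently_atTop_iff_infinite] at h3
        refine (h3.image hm.injective.injOn).mono ?_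
        rintro _ ⟨i, ⟨h4, h5⟩, rfl⟩
        exact ⟨⟨i, h5, rfl⟩, h4⟩
      exact hqj (by exact_mod_cast hab) ⟨f, hf⟩ ⟨inf (fun n => (b:ℝ) < f (x n)) hb,
        inf (fun n => f (x n) < (a:ℝ)) ha⟩
    intro f
    have hpos : 0 < ‖f‖ + 1 := by positivity
    obtain ⟨c, hc⟩ := h1 ((‖f‖ + 1)⁻¹ • f) (by
      rw [norm_smul, norm_inv, Real.norm_of_nonneg hpos.le, inv_mul_eq_div, div_le_one hpos]
      linarith)
    refine ⟨(‖f‖ + 1) * c, ?_⟩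
    have := hc.const_mul (‖f‖ + 1)
    refine this.congr fun j => ?_
    simp
    field_simp

end

theorem stmt6 {X : Type*} [NormedAddCommGroup X] [NormedSpace ℝ X] [CompleteSpace X] :
    HasDPrcP X ↔
      ∀ A : Set (X →L[ℝ] ℝ), Bornology.IsBounded A → IsLDPSet A := by
  constructor
  · intro h A hA
    refine ⟨hA, fun x hx hdp => ?_⟩
    obtain ⟨C, hC⟩ := hA.exists_norm_le
    have hx0 : Tendsto x atTop (𝓝 0) := by
      refine tendsto_of_subseq_tendsto fun ns hns => ?_
      obtain ⟨a, -, φ, hφ, ha⟩ := (h _ hdp).tendsto_subseq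
        (x := fun n => x (ns n)) (fun n => subset_closure ⟨_, rfl⟩)
      have : a = 0 := by
        by_contra hne
        obtain ⟨f, -, hf⟩ := exists_dual_vector ℝ a (norm_ne_zero_iff.2 hne)
        have h1 : Tendsto (fun n => f (x (ns (φ n)))) atTop (𝓝 (f a)) :=
          (f.continuous.tendsto a).comp ha
        have h2 : Tendsto (fun n => f (x (ns (φ n)))) atTop (𝓝 0) :=
          (hx f).comp (hns.comp hφ.tendsto_atTop)
        have h3 := tendsto_nhds_unique h1 h2
        rw [hf] at h3
        exact hne (by simpa using h3)
      subst this
      exact ⟨φ, ha⟩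
    have h0 : Tendsto (fun n => max C 0 * ‖x n‖) atTop (𝓝 0) := by
      simpa using hx0.norm.const_mul (max C 0)
    refine squeeze_zero (fun n => Real.iSup_nonneg fun _ => abs_nonneg _) (fun n => ?_) h0
    refine Real.iSup_le (fun f => ?_) (by positivity)
    refine (f.1.le_opNorm (x n)).trans ?_
    gcongr
    exact (hC _ f.2).trans (le_max_left _ _)
  · intro h A hA
    refine (TotallyBounded.closure ?_).isCompact_of_isClosed isClosed_closure
    rw [Metric.totallyBounded_iff]
    by_contra hnt
    push Not at hnt
    obtain ⟨ε, hε, hnt⟩ := hnt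
    obtain ⟨x, hxA, hxs⟩ := exists_seq_of_forall_finset_exists (fun z => z ∈ A)
      (fun z w => ε ≤ dist w z) (by
        intro s _
        obtain ⟨w, hw, hw2⟩ := Set.not_subset.1 (hnt s s.finite_toSet)
        refine ⟨w, hw, fun z hz => ?_⟩
        by_contra hc
        exact hw2 (Set.mem_biUnion (x := z) hz (by simpa using hc)))
    obtain ⟨m, hm, hc⟩ := hA.exists_wCauchy x hxA
    let y : ℕ → X := fun j => x (m (j+1)) - x (m j)
    have hy : WeaklyNull y := by
      intro f
      obtain ⟨c, hc⟩ := hc f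
      simpa [y] using ((tendsto_add_atTop_iff_nat 1).2 hc).sub hc
    have hyd : IsDPSet (Set.range y) := by
      constructor
      · obtain ⟨C, hC⟩ := hA.1.exists_norm_le
        refine isBounded_iff_forall_norm_le.2 ⟨C + C, ?_⟩
        rintro _ ⟨j, rfl⟩
        exact (norm_sub_le _ _).trans (add_le_add (hC _ (hxA _)) (hC _ (hxA _)))
      · intro f hf
        have h2 := (hA.2 f hf).const_mul 2
        rw [mul_zero] at h2
        refine squeeze_zero (fun n => Real.iSup_nonneg fun _ => abs_nonneg _) (fun n => ?_) h2
        refine Real.iSup_le ?_ (mul_nonneg zero_le_two (Real.iSup_nonneg fun _ => abs_nonneg _))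
        rintro ⟨_, j, rfl⟩
        have h3 := le_ciSup (hA.bdd (f n)) ⟨x (m (j+1)), hxA _⟩
        have h4 := le_ciSup (hA.bdd (f n)) ⟨x (m j), hxA _⟩
        simp only [y, map_sub]
        refine (abs_sub _ _).trans ?_
        linarith
    have ht := (h (closedBall 0 1) isBounded_closedBall).2 y hy hyd
    have : ε ≤ 0 := by
      refine ge_of_tendsto ht (Eventually.of_forall fun n => ?_)
      obtain ⟨f, hf1, hf⟩ := exists_dual_vector'' ℝ (y n)
      have hb : BddAbove (Set.range fun f : (closedBall 0 1 : Set (X →L[ℝ] ℝ)) => |f.1 (y n)|) := by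
        refine ⟨‖y n‖, ?_⟩
        rintro _ ⟨f, rfl⟩
        have hf1 : ‖f.1‖ ≤ 1 := mem_closedBall_zero_iff.1 f.2
        simpa using f.1.le_of_opNorm_le hf1 (y n)
      refine le_trans ?_ (le_ciSup hb ⟨f, by simpa using hf1⟩)
      simp only [hf]
      have := hxs (m n) (m (n+1)) (hm (Nat.lt_succ_self n))
      rw [dist_eq_norm] at this
      simpa [y] using this
    linarith
end
end

section
/- For a Banach space X, the following are equivalent: (1) X has the L-Dunford-Pettis property; (2) every Dunford-Pettis completely continuous operator from X into ℓ∞ is weakly compact; (3) the space of weakly compact operators W(X, ℓ∞) is complemented in the space of Dunford-Pettis completely continuous operators DPcc(X, ℓ∞). -/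
open Filter Topology Metric

noncomputable section

/-- `W` is complemented in `D` (both sets of operators) if there is a bounded linear
projection from `D` onto `W`. -/
def OpComplementedIn {X Y : Type*} [NormedAddCommGroup X] [NormedSpace ℝ X]
    [NormedAddCommGroup Y] [NormedSpace ℝ Y]
    (W D : Set (X →L[ℝ] Y)) : Prop :=
  ∃ P : (X →L[ℝ] Y) → (X →L[ℝ] Y),
    (∀ T ∈ D, ∀ S ∈ D, P (T + S) = P T + P S) ∧
    (∀ (c : ℝ), ∀ T ∈ D, P (c • T) = c • P T) ∧
    (∃ C : ℝ, ∀ T ∈ D, ‖P T‖ ≤ C * ‖T‖) ∧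
    (∀ T ∈ D, P T ∈ W) ∧
    (∀ T ∈ W, P T = T)

/-- Banach-Alaoglu along an ultrafilter. -/
theorem aux_lim {ι E : Type*} [NormedAddCommGroup E] [NormedSpace ℝ E] (U : Ultrafilter ι)
    (y : ι → E →L[ℝ] ℝ) (C : ℝ) (hy : ∀ᶠ i in (U : Filter ι), ‖y i‖ ≤ C) :
    ∃ φ : E →L[ℝ] ℝ, ∀ e, Tendsto (fun i => y i e) U (𝓝 (φ e)) := by
  have hc := WeakDual.isCompact_closedBall (𝕜 := ℝ) (E := E) 0 C
  obtain ⟨φ, -, hφ⟩ := hc.ultrafilter_le_nhds (U.map (fun i => StrongDual.toWeakDual (y i))) (by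
    simp only [le_principal_iff, Ultrafilter.mem_coe, Ultrafilter.mem_map]
    filter_upwards [hy] with i hi
    simpa using hi)
  refine ⟨WeakDual.toStrongDual φ, fun e => ?_⟩
  have h1 : Tendsto (fun i => StrongDual.toWeakDual (y i)) U (𝓝 φ) := hφ
  exact ((WeakDual.eval_continuous (𝕜 := ℝ) e).tendsto φ).comp h1

/-- Goldstine. -/
theorem aux_goldstine {E : Type*} [NormedAddCommGroup E] [NormedSpace ℝ E]
    (g : (E →L[ℝ] ℝ) →L[ℝ] ℝ) (R : ℝ) (hg : ‖g‖ ≤ R) :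
    ∃ G : Filter E, G.NeBot ∧ closedBall 0 R ∈ G ∧
      ∀ f : E →L[ℝ] ℝ, Tendsto (fun x => f x) G (𝓝 (g f)) := by
  have hR : 0 ≤ R := (norm_nonneg g).trans hg
  let J : E → (E →L[ℝ] ℝ) → ℝ := fun x f => f x
  have hmem : ∀ (F : Finset (E →L[ℝ] ℝ)), (fun i : F => g i) ∈
      closure ((fun x : E => fun i : F => (i : E →L[ℝ] ℝ) x) '' closedBall 0 R) := by
    intro F
    classical
    by_contra hcon
    let L : E →ₗ[ℝ] (F → ℝ) := LinearMap.pi (fun i : F => ((i : E →L[ℝ] ℝ) : E →ₗ[ℝ] ℝ))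
    have hconv : Convex ℝ ((fun x : E => fun i : F => (i : E →L[ℝ] ℝ) x) '' closedBall 0 R) :=
      (convex_closedBall (0:E) R).linear_image L
    obtain ⟨c, u, h1, h2⟩ := geometric_hahn_banach_closed_point hconv.closure isClosed_closure hcon
    have hc : ∀ v : F → ℝ, c v = ∑ i, v i * c (Pi.single i 1) := by
      intro v
      conv_lhs => rw [pi_eq_sum_univ' v]
      simp [map_sum]
    let f : E →L[ℝ] ℝ := ∑ i : F, (c (Pi.single i 1)) • (i : E →L[ℝ] ℝ)
    have hf : ∀ x, ‖x‖ ≤ R → f x < u := by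
      intro x hx
      have := h1 _ (subset_closure ⟨x, by simpa using hx, rfl⟩)
      rw [hc] at this
      simpa [f, mul_comm] using this
    have hgf : u < g f := by
      rw [hc] at h2
      simpa [f, mul_comm] using h2
    have hu : 0 < u := by simpa using hf 0 (by simpa using hR)
    have hfR : R * ‖f‖ ≤ u := by
      rcases hR.eq_or_lt with h0 | h0
      · rw [← h0]; simpa using hu.le
      · have : ‖f‖ ≤ u / R := by
          refine f.opNorm_le_of_unit_norm (div_nonneg hu.le hR) ?_
          intro x hx
          rw [le_div_iff₀ h0, Real.norm_eq_abs]
          have a1 := hf (R • x) (by rw [norm_smul, hx]; simp [abs_of_pos h0])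
          have a2 := hf (-(R • x)) (by rw [norm_neg, norm_smul, hx]; simp [abs_of_pos h0])
          simp only [map_neg, map_smul, smul_eq_mul] at a1 a2
          rcases abs_cases (f x) with ⟨h, _⟩ | ⟨h, _⟩ <;> rw [h] <;> nlinarith
        rw [le_div_iff₀ h0] at this; linarith
    have : g f ≤ ‖g‖ * ‖f‖ := (le_abs_self _).trans (g.le_opNorm f)
    have := mul_le_mul_of_nonneg_right hg (norm_nonneg f)
    linarith
  let G : Filter E := comap J (𝓝 (fun f => g f)) ⊓ 𝓟 (closedBall 0 R)
  refine ⟨G, ?_, mem_inf_of_right (mem_principal_self _), fun f => ?_⟩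
  · have h0 : (fun f => g f) ∈ closure (J '' closedBall 0 R) := by
      rw [_root_.mem_closure_iff]
      intro o ho hgo
      obtain ⟨I, v, hv, hsub⟩ := isOpen_pi_iff.1 ho _ hgo
      have ho' : IsOpen (Set.pi Set.univ (fun i : I => v i)) :=
        isOpen_set_pi Set.finite_univ (fun i _ => (hv i i.2).1)
      obtain ⟨_, hz, x, hx, rfl⟩ := _root_.mem_closure_iff.1 (hmem I) _ ho' (fun i _ => (hv i i.2).2)
      exact ⟨J x, hsub fun i hi => hz ⟨i, hi⟩ trivial, x, hx, rfl⟩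
    rw [mem_closure_iff_clusterPt, ClusterPt, ← map_principal, ← Filter.push_pull'] at h0
    exact h0.of_map
  · have : Tendsto J G (𝓝 (fun f => g f)) := tendsto_comap.mono_left inf_le_left
    exact (tendsto_pi_nhds.1 this) f

/-- Non relatively weakly compact bounded sets give an ultrafilter without weak limit. -/
theorem aux_nonrwc {E : Type*} [NormedAddCommGroup E] [NormedSpace ℝ E] (K : Set E)
    (hb : Bornology.IsBounded K) (hK : ¬ RelWeaklyCompact K) :
    ∃ (U : Filter E) (ψ : (E →L[ℝ] ℝ) →L[ℝ] ℝ), U.NeBot ∧ K ∈ U ∧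
      (∀ f : E →L[ℝ] ℝ, Tendsto (fun x => f x) U (𝓝 (ψ f))) ∧
      ∀ x : E, ψ ≠ NormedSpace.inclusionInDoubleDual ℝ E x := by
  have h : ¬ closure (NormedSpace.inclusionInDoubleDualWeak ℝ E '' (toWeakSpace ℝ E '' K)) ⊆
      Set.range (NormedSpace.inclusionInDoubleDualWeak ℝ E) := by
    intro h
    apply hK
    refine NormedSpace.isCompact_closure_of_isBounded _ _ _ ?_ h
    rwa [Set.preimage_image_eq _ (toWeakSpace ℝ E).injective]
  rw [Set.not_subset] at h
  obtain ⟨ψ, h1, h2⟩ := h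
  rw [Set.image_image, mem_closure_iff_clusterPt, ClusterPt] at h1
  let q : E → WeakDual ℝ (StrongDual ℝ E) :=
    fun x => NormedSpace.inclusionInDoubleDualWeak ℝ E (toWeakSpace ℝ E x)
  refine ⟨comap q (𝓝 ψ) ⊓ 𝓟 K, WeakDual.toStrongDual ψ, ?_, mem_inf_of_right (mem_principal_self _), ?_, ?_⟩
  · rw [← map_principal, ← Filter.push_pull'] at h1
    exact h1.of_map
  · intro f
    have : Tendsto q (comap q (𝓝 ψ) ⊓ 𝓟 K) (𝓝 ψ) := tendsto_comap.mono_left inf_le_left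
    exact ((WeakDual.eval_continuous (𝕜 := ℝ) f).tendsto ψ).comp this
  · intro x hx
    exact h2 ⟨toWeakSpace ℝ E x, hx.symm⟩

/-- Double limit lemma. -/
theorem aux_double {P Q : Type*} (u : P → Q → ℝ) (F : Filter P) (G : Filter Q) [F.NeBot] [G.NeBot]
    (R : P → ℝ) (L : Q → ℝ) (a b : ℝ) (hab : a < b)
    (hL : ∀ q, Tendsto (fun p => u p q) F (𝓝 (L q)))
    (hR : ∀ p, Tendsto (fun q => u p q) G (𝓝 (R p)))
    (hLa : Tendsto L G (𝓝 a)) (hRb : Tendsto R F (𝓝 b)) (A : Set P) (hA : A ∈ F)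
    (B : Set Q) (hB : B ∈ G) :
    ∃ (p : ℕ → P) (q : ℕ → Q) (α β : ℝ), α < β ∧ (∀ n, p n ∈ A) ∧ (∀ n, q n ∈ B) ∧
      (∀ n m, n ≤ m → β ≤ u (p n) (q m)) ∧ (∀ n m, m < n → u (p n) (q m) ≤ α) := by
  obtain ⟨α, h1, h2⟩ := exists_between hab
  obtain ⟨β, h3, h4⟩ := exists_between h2
  obtain ⟨f, hf1, hf2⟩ := exists_seq_of_forall_finset_exists
    (fun x : P × Q => x.1 ∈ A ∧ x.2 ∈ B ∧ β < R x.1 ∧ L x.2 < α ∧ β < u x.1 x.2)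
    (fun x y => u y.1 x.2 < α ∧ β < u x.1 y.2) (by
      intro s hs
      have e1 : ∀ᶠ p in F, ∀ t ∈ s, u p t.2 < α := by
        rw [Filter.eventually_all_finset]
        exact fun t ht => (hL t.2).eventually_lt_const (hs t ht).2.2.2.1
      obtain ⟨p, hp1, hp2, hp3⟩ :=
        (e1.and ((hRb.eventually_const_lt h4).and hA)).exists
      have e2 : ∀ᶠ q in G, ∀ t ∈ s, β < u t.1 q := by
        rw [Filter.eventually_all_finset]
        exact fun t ht => (hR t.1).eventually_const_lt (hs t ht).2.2.1
      obtain ⟨q, hq1, hq2, hq3, hq4⟩ :=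
        (e2.and ((hLa.eventually_lt_const h1).and
          (((hR p).eventually_const_lt hp2).and hB))).exists
      exact ⟨(p, q), ⟨hp3, hq4, hp2, hq2, hq3⟩, fun t ht => ⟨hp1 t ht, hq1 t ht⟩⟩)
  refine ⟨fun n => (f n).1, fun n => (f n).2, α, β, h3, fun n => (hf1 n).1,
    fun n => (hf1 n).2.1, ?_, ?_⟩
  · intro n m hnm
    rcases hnm.eq_or_lt with rfl | h
    · exact (hf1 n).2.2.2.2.le
    · exact (hf2 n m h).2.le
  · exact fun n m h => (hf2 m n h).1.le

/-- The converse. -/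
theorem aux_conv {E : Type*} [NormedAddCommGroup E] [NormedSpace ℝ E] (K : Set E)
    (hK : RelWeaklyCompact K) (y : ℕ → E) (hy : ∀ m, y m ∈ K)
    (φ : ℕ → E →L[ℝ] ℝ) (C : ℝ) (hφ : ∀ n, ‖φ n‖ ≤ C) (M : Set ℕ) (hM : M.Infinite) (α β : ℝ)
    (hαβ : α < β) (h1 : ∀ n m, n ∈ M → n ≤ m → β ≤ φ n (y m))
    (h2 : ∀ n m, n ∈ M → m < n → φ n (y m) ≤ α) : False := by
  let U := hyperfilter ℕ
  have hU : (U : Filter ℕ) ≤ atTop := Nat.hyperfilter_le_atTop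
  obtain ⟨z, -, hz⟩ := hK.ultrafilter_le_nhds (U.map (fun m => toWeakSpace ℝ E (y m))) (by
    simp only [le_principal_iff, Ultrafilter.mem_coe, Ultrafilter.mem_map]
    exact Filter.univ_mem' fun m => subset_closure ⟨y m, hy m, rfl⟩)
  have hz' : Tendsto (fun m => toWeakSpace ℝ E (y m)) U (𝓝 z) := hz
  let w : E := (toWeakSpace ℝ E).symm z
  have hw : ∀ f : E →L[ℝ] ℝ, Tendsto (fun m => f (y m)) U (𝓝 (f w)) := by
    intro f
    have hc : Continuous (fun v : WeakSpace ℝ E => f ((toWeakSpace ℝ E).symm v)) :=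
      WeakBilin.eval_continuous (topDualPairing ℝ E).flip f
    exact (hc.tendsto z).comp hz'
  have hne : (atTop ⊓ 𝓟 M : Filter ℕ).NeBot := by
    rw [← frequently_mem_iff_neBot]
    exact Nat.frequently_atTop_iff_infinite.2 hM
  let V := Ultrafilter.of (atTop ⊓ 𝓟 M : Filter ℕ)
  have hV : (V : Filter ℕ) ≤ atTop ⊓ 𝓟 M := Ultrafilter.of_le _
  have hVM : ∀ᶠ n in (V : Filter ℕ), n ∈ M := hV (mem_inf_of_right (mem_principal_self _))
  have hVt : (V : Filter ℕ) ≤ atTop := hV.trans inf_le_left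
  obtain ⟨Φ, hΦ⟩ := aux_lim V φ C (Eventually.of_forall hφ)
  have a1 : ∀ n ∈ M, β ≤ φ n w := fun n hn =>
    ge_of_tendsto (hw (φ n)) (by
      filter_upwards [hU (eventually_ge_atTop n)] with m hm using h1 n m hn hm)
  have a2 : ∀ m, Φ (y m) ≤ α := fun m =>
    le_of_tendsto (hΦ (y m)) (by
      filter_upwards [hVM, hVt (eventually_gt_atTop m)] with n hn hm using h2 n m hn hm)
  have a3 : β ≤ Φ w := ge_of_tendsto (hΦ w) (hVM.mono a1)
  have a4 : Φ w ≤ α := le_of_tendsto (hw Φ) (Eventually.of_forall a2)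
  linarith

/-- Indicator sequences in `ℓ∞`. -/
def chiSeq (S : Set ℕ) : ellInfty :=
  ⟨S.indicator (fun _ => (1:ℝ)), memℓp_infty ⟨1, by
    rintro _ ⟨n, rfl⟩
    by_cases h : n ∈ S <;> simp [h]⟩⟩

theorem chiSeq_apply (S : Set ℕ) (n : ℕ) : chiSeq S n = S.indicator (fun _ => (1:ℝ)) n := rfl

theorem aux_countable {I : Type*} (M : I → Set ℕ)
    (hM : ∀ i j, i ≠ j → (M i ∩ M j).Finite) (l : ellInfty →ₗ[ℝ] ℝ) (C : ℝ)
    (hl : ∀ b, |l b| ≤ C * ‖b‖) (h0 : ∀ n, l (chiSeq {n}) = 0) :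
    {i | l (chiSeq (M i)) ≠ 0}.Countable := by
  classical
  have hfin : ∀ S : Set ℕ, S.Finite → l (chiSeq S) = 0 := by
    intro S hS
    induction S, hS using Set.Finite.induction_on with
    | empty =>
      have : chiSeq ∅ = 0 := by ext n; simp [chiSeq_apply]
      rw [this, map_zero]
    | @insert a S ha hS ih =>
      have : chiSeq (insert a S) = chiSeq {a} + chiSeq S := by
        ext n
        rw [lp.coeFn_add, Pi.add_apply, chiSeq_apply, chiSeq_apply, chiSeq_apply]
        by_cases h1 : n = a
        · subst h1; simp [ha]
        · by_cases h2 : n ∈ S <;> simp [h1, h2]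
      rw [this, map_add, h0, ih, add_zero]
  have hdiff : ∀ S F : Set ℕ, F.Finite → l (chiSeq (S \ F)) = l (chiSeq S) := by
    intro S F hF
    have : chiSeq S = chiSeq (S \ F) + chiSeq (S ∩ F) := by
      ext n
      rw [lp.coeFn_add, Pi.add_apply, chiSeq_apply, chiSeq_apply, chiSeq_apply]
      by_cases h1 : n ∈ S <;> by_cases h2 : n ∈ F <;> simp [h1, h2]
    rw [this, map_add, hfin (S ∩ F) (hF.subset Set.inter_subset_right), add_zero]
  have hC : 0 ≤ C := by
    have h := hl (chiSeq {0})
    rw [h0, abs_zero] at h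
    have hp : 0 < ‖chiSeq {0}‖ := by
      rw [norm_pos_iff]
      intro h
      have := congrArg (fun z : ellInfty => z 0) h
      simp [chiSeq_apply] at this
    exact nonneg_of_mul_nonneg_left h hp
  have hε : ∀ ε : ℝ, 0 < ε → {i | ε ≤ |l (chiSeq (M i))|}.Finite := by
    intro ε hε
    by_contra hinf
    obtain ⟨N, hN⟩ := exists_nat_gt (C / ε)
    obtain ⟨t, ht, hcard⟩ := Set.Infinite.exists_subset_card_eq hinf N
    let F : Set ℕ := ⋃ i ∈ t, ⋃ j ∈ t, if i = j then ∅ else M i ∩ M j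
    have hF : F.Finite := by
      refine t.finite_toSet.biUnion fun i _ => t.finite_toSet.biUnion fun j _ => ?_
      split_ifs with h
      · exact Set.finite_empty
      · exact hM i j h
    have hFm : ∀ i ∈ t, ∀ j ∈ t, i ≠ j → ∀ n, n ∈ M i → n ∈ M j → n ∈ F := by
      intro i hi j hj hij n h1 h2
      simp only [F, Set.mem_iUnion]
      exact ⟨i, hi, j, hj, by rw [if_neg hij]; exact ⟨h1, h2⟩⟩
    let s : I → ℝ := fun i => SignType.sign (l (chiSeq (M i)))
    let b : ellInfty := ∑ i ∈ t, s i • chiSeq (M i \ F)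
    have hs : ∀ i, |s i| ≤ 1 := by
      intro i
      simp only [s]
      rcases SignType.sign (l (chiSeq (M i))) <;> simp
    have hb : ‖b‖ ≤ 1 := by
      refine lp.norm_le_of_forall_le zero_le_one fun n => ?_
      have hbn : b n = ∑ i ∈ t, s i * (M i \ F).indicator (fun _ => (1:ℝ)) n := by
        simp only [b, lp.coeFn_sum, Finset.sum_apply, lp.coeFn_smul, Pi.smul_apply, smul_eq_mul,
          chiSeq_apply]
      rw [hbn, Real.norm_eq_abs]
      by_cases h : ∃ i ∈ t, n ∈ M i \ F
      · obtain ⟨i, hi, hn⟩ := h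
        rw [Finset.sum_eq_single i]
        · simpa [hn] using hs i
        · intro j hj hji
          have : n ∉ M j \ F := fun h => hn.2 (hFm i hi j hj hji.symm n hn.1 h.1)
          simp [this]
        · exact fun h => absurd hi h
      · push Not at h
        rw [Finset.sum_eq_zero]
        · simp
        · intro i hi
          simp [h i hi]
    have hlb : l b = ∑ i ∈ t, |l (chiSeq (M i))| := by
      simp only [b, map_sum, map_smul, hdiff _ F hF, s, smul_eq_mul, sign_mul_self]
    have h1 : N * ε ≤ l b := by
      rw [hlb, ← hcard, ← nsmul_eq_mul]
      exact Finset.card_nsmul_le_sum _ _ _ fun i hi => ht hi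
    have h2 : l b ≤ C := (le_abs_self _).trans ((hl b).trans (by nlinarith))
    rw [div_lt_iff₀ hε] at hN
    linarith
  have : {i | l (chiSeq (M i)) ≠ 0} = ⋃ k : ℕ, {i | 1 / ((k:ℝ) + 1) ≤ |l (chiSeq (M i))|} := by
    ext i
    simp only [Set.mem_ofPred_eq, Set.mem_iUnion]
    constructor
    · intro h
      obtain ⟨k, hk⟩ := exists_nat_one_div_lt (abs_pos.2 h)
      exact ⟨k, hk.le⟩
    · rintro ⟨k, hk⟩ h
      rw [h, abs_zero] at hk
      have : 0 < 1 / ((k:ℝ) + 1) := by positivity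
      linarith
  rw [this]
  exact Set.countable_iUnion fun k => (hε _ (by positivity)).countable

/-- An uncountable almost disjoint family. -/
theorem aux_ad : ∃ M : (ℕ → Bool) → Set ℕ, (∀ i, (M i).Infinite) ∧
    ∀ i j, i ≠ j → (M i ∩ M j).Finite := by
  let e : (ℕ → Bool) → ℕ → ℕ := fun x n => Encodable.encode ((List.range n).map x)
  have he : ∀ x y n m, e x n = e y m → n = m ∧ ∀ k < n, x k = y k := by
    intro x y n m h
    have h' := Encodable.encode_injective h
    have hlen : n = m := by simpa using congrArg List.length h'
    subst hlen
    refine ⟨rfl, fun k hk => ?_⟩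
    exact List.map_inj_left.1 h' k (List.mem_range.2 hk)
  refine ⟨fun x => Set.range (e x), fun x => ?_, fun x y hxy => ?_⟩
  · exact Set.infinite_range_of_injective fun n m h => (he x x n m h).1
  · obtain ⟨k, hk⟩ := Function.ne_iff.1 hxy
    refine ((Set.finite_Iic k).image (e x)).subset ?_
    rintro _ ⟨⟨n, rfl⟩, ⟨m, hm⟩⟩
    refine ⟨n, ?_, rfl⟩
    by_contra hn
    exact hk ((he x y n m hm.symm).2 k (by simpa using hn))

theorem uncountable_bool : Uncountable (ℕ → Bool) := by
  rw [← Cardinal.aleph0_lt_mk_iff]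
  simpa using Cardinal.cantor Cardinal.aleph0

/-- Operator into `ℓ∞` from a bounded sequence of functionals. -/
theorem aux_op {X : Type*} [NormedAddCommGroup X] [NormedSpace ℝ X] (a : ℕ → X →L[ℝ] ℝ) (C : ℝ)
    (ha : ∀ n, ‖a n‖ ≤ C) : ∃ S : X →L[ℝ] ellInfty, ∀ x n, S x n = a n x := by
  have hC : 0 ≤ C := (norm_nonneg _).trans (ha 0)
  have hb : ∀ x n, ‖a n x‖ ≤ C * ‖x‖ := fun x n => (a n).le_of_opNorm_le (ha n) x
  let L : X →ₗ[ℝ] ellInfty :=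
    { toFun := fun x => ⟨fun n => a n x, memℓp_infty ⟨C * ‖x‖, by
        rintro _ ⟨n, rfl⟩; exact hb x n⟩⟩
      map_add' := fun x y => by
        ext n
        exact map_add (a n) x y
      map_smul' := fun c x => by
        ext n
        exact map_smul (a n) c x }
  refine ⟨L.mkContinuous C fun x => lp.norm_le_of_forall_le (by positivity) fun n => hb x n, ?_⟩
  intro x n
  rfl

/-- Rank one operators are weakly compact. -/
theorem aux_rank_one {X Y : Type*} [NormedAddCommGroup X] [NormedSpace ℝ X]
    [NormedAddCommGroup Y] [NormedSpace ℝ Y] (T : X →L[ℝ] Y) (f : X →L[ℝ] ℝ) (y : Y)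
    (h : ∀ x, T x = f x • y) : IsWeaklyCompactOp T := by
  have hc : IsCompact ((fun c : ℝ => toWeakSpaceCLM ℝ Y (c • y)) '' Set.Icc (-‖f‖) ‖f‖) :=
    isCompact_Icc.image ((toWeakSpaceCLM ℝ Y).continuous.comp (by fun_prop))
  refine hc.closure_of_subset ?_
  rintro _ ⟨_, ⟨x, hx, rfl⟩, rfl⟩
  refine ⟨f x, ?_, by simp [h]⟩
  have : ‖f x‖ ≤ ‖f‖ := f.unit_le_opNorm x (by simpa using hx)
  exact abs_le.1 this

theorem coord_clm (n : ℕ) : ∃ e : ellInfty →L[ℝ] ℝ, ‖e‖ ≤ 1 ∧ ∀ y, e y = y n := by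
  let L : ellInfty →ₗ[ℝ] ℝ :=
    { toFun := fun y => y n
      map_add' := fun x y => by simp
      map_smul' := fun c x => by simp }
  have hL : ∀ y, ‖L y‖ ≤ 1 * ‖y‖ := fun y => by
    rw [one_mul]; exact lp.norm_apply_le_norm (by simp) y n
  exact ⟨L.mkContinuous 1 hL, L.mkContinuous_norm_le zero_le_one hL, fun y => rfl⟩

theorem aux_closed_range {E : Type*} [NormedAddCommGroup E] [NormedSpace ℝ E] [CompleteSpace E] :
    IsClosed (Set.range (NormedSpace.inclusionInDoubleDual ℝ E)) := by
  have h := (NormedSpace.inclusionInDoubleDualLi (E := E) ℝ).isometry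
  have h2 := h.isUniformInducing.isComplete_range
  exact h2.isClosed

theorem aux_scale {E : Type*} [NormedAddCommGroup E] [NormedSpace ℝ E] (g : E) :
    ∃ c : ℝ, 0 < c ∧ ‖c • g‖ ≤ 1 := by
  have hpos : 0 < ‖g‖ + 1 := by positivity
  refine ⟨(‖g‖ + 1)⁻¹, inv_pos.2 hpos, ?_⟩
  rw [norm_smul, norm_inv, Real.norm_eq_abs, abs_of_pos hpos, inv_mul_le_iff₀ hpos]
  linarith

theorem aux_sep {F E : Type*} [NormedAddCommGroup F] [NormedSpace ℝ F] [NormedAddCommGroup E]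
    [NormedSpace ℝ E] (J : E →L[ℝ] F) (hcl : IsClosed (Set.range J)) (ψ : F)
    (hψ : ψ ∉ Set.range J) : ∃ Φ : F →L[ℝ] ℝ, (∀ x, Φ (J x) = 0) ∧ Φ ψ < 0 := by
  have hcv : Convex ℝ (Set.range J) := (LinearMap.range J.toLinearMap).convex
  obtain ⟨Φ, u, h1, h2⟩ := geometric_hahn_banach_closed_point hcv hcl hψ
  have hu : 0 < u := by simpa using h1 _ ⟨0, rfl⟩
  have hΦ0 : ∀ x, Φ (J x) = 0 := by
    intro x
    by_contra hx
    have := h1 _ ⟨(u / Φ (J x)) • x, rfl⟩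
    rw [map_smul, map_smul, smul_eq_mul, div_mul_cancel₀ _ hx] at this
    exact lt_irrefl _ this
  refine ⟨-Φ, fun x => by simp [hΦ0], ?_⟩
  simp only [_root_.neg_apply]
  linarith

theorem aux_goldstine' {E : Type*} [NormedAddCommGroup E] [NormedSpace ℝ E]
    (g : (E →L[ℝ] ℝ) →L[ℝ] ℝ) :
    ∃ (R : ℝ) (G : Filter E), 0 ≤ R ∧ G.NeBot ∧ closedBall 0 R ∈ G ∧
      ∀ f : E →L[ℝ] ℝ, Tendsto (fun x => f x) G (𝓝 (g f)) := by
  obtain ⟨G, h⟩ := aux_goldstine g ‖g‖ le_rfl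
  exact ⟨‖g‖, G, norm_nonneg g, h⟩

theorem aux_seq {E : Type*} [NormedAddCommGroup E] [NormedSpace ℝ E] [CompleteSpace E]
    (K : Set E) (hbd : Bornology.IsBounded K) (hcon : ¬ RelWeaklyCompact K) :
    ∃ (p : ℕ → E) (q : ℕ → E →L[ℝ] ℝ) (α β r : ℝ), 0 ≤ r ∧ α < β ∧ (∀ n, p n ∈ K) ∧
      (∀ n, q n ∈ closedBall 0 r) ∧
      (∀ n m, n ≤ m → β ≤ q m (p n)) ∧ (∀ n m, m < n → q m (p n) ≤ α) := by
  obtain ⟨U, ψ, hU, hKU, hψ, hne⟩ := aux_nonrwc K hbd hcon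
  have hcl : IsClosed (Set.range (NormedSpace.inclusionInDoubleDual ℝ E)) :=
    aux_closed_range
  obtain ⟨Φ, hΦ0, hΦ⟩ := aux_sep (NormedSpace.inclusionInDoubleDual ℝ E) hcl ψ
    (by rintro ⟨x, hx⟩; exact hne x hx.symm)
  obtain ⟨r, G, hr, hG, hGB, hGl⟩ := aux_goldstine' Φ
  obtain ⟨p, q, α, β, hαβ, hp, hq, c1, c2⟩ := aux_double
    (fun (x : E) (f : E →L[ℝ] ℝ) => f x) U G (fun _ => 0) (fun f => ψ f)
    (Φ ψ) 0 hΦ hψ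
    (fun x => by
      have := hGl (NormedSpace.inclusionInDoubleDual ℝ E x)
      rw [hΦ0] at this
      exact this)
    (hGl ψ) tendsto_const_nhds _ hKU _ hGB
  exact ⟨p, q, α, β, r, hr, hαβ, hp, hq, c1, c2⟩

theorem aux_12 {X : Type*} [NormedAddCommGroup X] [NormedSpace ℝ X]
    (hX : HasLDPProperty X) (T : X →L[ℝ] ellInfty) (hT : IsDPcc T) : IsWeaklyCompactOp T := by
  by_contra hcon
  have hbd : Bornology.IsBounded (T '' closedBall 0 1) :=
    T.lipschitz.isBounded_image isBounded_closedBall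
  obtain ⟨p, q, α, β, r, hr, hαβ, hp, hq, c1, c2⟩ := aux_seq _ hbd hcon
  choose x hx hxp using hp
  let A : Set (X →L[ℝ] ℝ) := (fun b : ellInfty →L[ℝ] ℝ => b ∘L T) '' closedBall 0 r
  have hA : IsLDPSet A := by
    constructor
    · rw [isBounded_iff_forall_norm_le]
      refine ⟨r * ‖T‖, ?_⟩
      rintro _ ⟨b, hb, rfl⟩
      refine (b.opNorm_comp_le T).trans ?_
      have : ‖b‖ ≤ r := by simpa using hb
      gcongr
    · intro z hz hz'
      have ht := (hT z hz hz').const_mul r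
      rw [mul_zero] at ht
      refine squeeze_zero (fun n => Real.iSup_nonneg fun _ => abs_nonneg _) (fun n => ?_) ht
      refine Real.iSup_le ?_ (by positivity)
      rintro ⟨_, b, hb, rfl⟩
      exact b.le_of_opNorm_le (by simpa using hb) (T (z n))
  refine aux_conv A (hX A hA) (fun m => (q m) ∘L T) (fun m => ⟨q m, hq m, rfl⟩)
    (fun n => NormedSpace.inclusionInDoubleDual ℝ X (x n)) 1 (fun n => ?_) Set.univ
    Set.infinite_univ α β hαβ (fun n m _ h => ?_) (fun n m _ h => ?_)
  · exact (NormedSpace.double_dual_bound ℝ X _).trans (by simpa using hx n)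
  · have := c1 n m h
    rw [← hxp] at this
    exact this
  · have := c2 n m h
    rw [← hxp] at this
    exact this

theorem aux_31 {X : Type*} [NormedAddCommGroup X] [NormedSpace ℝ X]
    (h : OpComplementedIn {T : X →L[ℝ] ellInfty | IsWeaklyCompactOp T}
        {T : X →L[ℝ] ellInfty | IsDPcc T}) : HasLDPProperty X := by
  obtain ⟨P, hadd, hsmul, ⟨C, hC⟩, hPW, hWP⟩ := h
  intro A hA
  by_contra hcon
  obtain ⟨U, ψ, hU, hKU, hψ, hne⟩ := aux_nonrwc _ hA.1 hcon
  let h : X →L[ℝ] ℝ := ψ ∘L NormedSpace.inclusionInDoubleDual ℝ X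
  have hg : ∃ g : (X →L[ℝ] ℝ) →L[ℝ] ℝ, ‖g‖ ≤ 1 ∧ g h < ψ g := by
    by_contra hno
    push Not at hno
    apply hne h
    have hle : ∀ g : (X →L[ℝ] ℝ) →L[ℝ] ℝ, ψ g ≤ g h := by
      intro g
      obtain ⟨c, hc0, hc1⟩ := aux_scale g
      have := hno (c • g) hc1
      simp only [map_smul, smul_eq_mul, _root_.smul_apply] at this
      exact le_of_mul_le_mul_left this hc0
    ext g
    have h1 := hle g
    have h2 := hle (-g)
    simp only [map_neg, _root_.neg_apply] at h2
    simp only [NormedSpace.dual_def]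
    linarith
  obtain ⟨g, hg1, hg2⟩ := hg
  obtain ⟨G, hG, hGB, hGl⟩ := aux_goldstine g 1 hg1
  obtain ⟨a, x, α, β, hαβ, ha, hx, c1, c2⟩ := aux_double
    (fun (f : X →L[ℝ] ℝ) (x : X) => f x) U G (fun f => g f) (fun x => h x)
    (g h) (ψ g) hg2 (fun x => hψ (NormedSpace.inclusionInDoubleDual ℝ X x)) hGl (hGl h) (hψ g)
    _ hKU _ hGB
  obtain ⟨B, hB⟩ := isBounded_iff_forall_norm_le.1 hA.1
  obtain ⟨S, hS⟩ := aux_op a B (fun n => hB _ (ha n))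
  have hSD : IsDPcc S := by
    intro z hz hz'
    refine squeeze_zero (fun n => norm_nonneg _) (fun n => ?_) (hA.2 z hz hz')
    refine lp.norm_le_of_forall_le (Real.iSup_nonneg fun _ => abs_nonneg _) fun k => ?_
    rw [hS]
    refine le_ciSup (f := fun f : A => |(f : X →L[ℝ] ℝ) (z n)|) ⟨B * ‖z n‖, ?_⟩ ⟨a k, ha k⟩
    rintro _ ⟨f, rfl⟩
    exact (f : X →L[ℝ] ℝ).le_of_opNorm_le (hB _ f.2) _
  let Tb : ellInfty → X →L[ℝ] ellInfty := fun b => (ContinuousLinearMap.mul ℝ ellInfty b) ∘L S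
  have hTb : ∀ b y, Tb b y = b * S y := fun b y => rfl
  have hTn : ∀ b y n, Tb b y n = b n * a n y := by
    intro b y n
    rw [hTb, lp.infty_coeFn_mul, Pi.mul_apply, hS]
  have hTadd : ∀ b c, Tb (b + c) = Tb b + Tb c := by
    intro b c; simp [Tb, ContinuousLinearMap.add_comp]
  have hTsmul : ∀ (r : ℝ) b, Tb (r • b) = r • Tb b := by
    intro r b; simp [Tb, ContinuousLinearMap.smul_comp]
  have hTD : ∀ b, IsDPcc (Tb b) := by
    intro b z hz hz'
    have ht := (hSD z hz hz').const_mul ‖b‖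
    rw [mul_zero] at ht
    exact squeeze_zero (fun n => norm_nonneg _) (fun n => norm_mul_le _ _) ht
  have hTnorm : ∀ b, ‖Tb b‖ ≤ ‖S‖ * ‖b‖ := by
    intro b
    refine ContinuousLinearMap.opNorm_le_bound _ (by positivity) fun y => ?_
    rw [hTb]
    calc ‖b * S y‖ ≤ ‖b‖ * ‖S y‖ := norm_mul_le _ _
      _ ≤ ‖b‖ * (‖S‖ * ‖y‖) := by gcongr; exact S.le_opNorm y
      _ = _ := by ring
  obtain ⟨M, hMinf, hMad⟩ := aux_ad
  let l : ℕ × ℕ → ellInfty →ₗ[ℝ] ℝ := fun mk =>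
    { toFun := fun b => (Tb b (x mk.1) - P (Tb b) (x mk.1) : ellInfty) mk.2
      map_add' := fun b c => by
        rw [hTadd, hadd _ (hTD b) _ (hTD c)]
        simp only [_root_.add_apply, lp.coeFn_sub, lp.coeFn_add, Pi.sub_apply,
          Pi.add_apply]
        ring
      map_smul' := fun r b => by
        rw [hTsmul, hsmul _ _ (hTD b)]
        simp only [_root_.smul_apply, lp.coeFn_sub, lp.coeFn_smul, Pi.sub_apply,
          Pi.smul_apply, smul_eq_mul, RingHom.id_apply]
        ring }
  have hlv : ∀ mk b, l mk b = (Tb b (x mk.1) - P (Tb b) (x mk.1) : ellInfty) mk.2 :=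
    fun _ _ => rfl
  have hcount : ∀ mk, {i | l mk (chiSeq (M i)) ≠ 0}.Countable := by
    intro mk
    refine aux_countable M hMad (l mk) ((1 + |C|) * ‖S‖ ) (fun b => ?_) (fun n => ?_)
    · rw [hlv]
      have hxm : ‖x mk.1‖ ≤ 1 := by simpa using hx mk.1
      have e1 : ‖Tb b (x mk.1)‖ ≤ ‖S‖ * ‖b‖ :=
        ((Tb b).unit_le_opNorm _ hxm).trans (hTnorm b)
      have e2 : ‖P (Tb b) (x mk.1)‖ ≤ |C| * (‖S‖ * ‖b‖) := by
        refine ((P (Tb b)).unit_le_opNorm _ hxm).trans ((hC _ (hTD b)).trans ?_)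
        exact mul_le_mul (le_abs_self C) (hTnorm b) (norm_nonneg _) (abs_nonneg _)
      have e3 := lp.norm_apply_le_norm (by simp) (Tb b (x mk.1) - P (Tb b) (x mk.1)) mk.2
      rw [Real.norm_eq_abs] at e3
      have e4 := norm_sub_le (Tb b (x mk.1)) (P (Tb b) (x mk.1))
      calc _ ≤ _ := e3
        _ ≤ _ := e4
        _ ≤ _ := add_le_add e1 e2
        _ = _ := by ring
    · have hw : IsWeaklyCompactOp (Tb (chiSeq {n})) := by
        refine aux_rank_one _ (a n) (chiSeq {n}) fun y => ?_
        ext k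
        rw [hTn, lp.coeFn_smul, Pi.smul_apply, smul_eq_mul, chiSeq_apply]
        by_cases hk : k = n
        · subst hk; simp
        · simp [hk]
      rw [hlv, hWP _ hw, sub_self]
      rfl
  have hall : (⋃ mk, {i | l mk (chiSeq (M i)) ≠ 0}).Countable := Set.countable_iUnion hcount
  obtain ⟨i, hi⟩ : ∃ i, i ∉ ⋃ mk, {i | l mk (chiSeq (M i)) ≠ 0} := by
    by_contra hno
    push Not at hno
    have := uncountable_bool
    exact Set.not_countable_univ (hall.mono fun i _ => hno i)
  simp only [Set.mem_iUnion, Set.mem_ofPred_eq, not_exists, not_not] at hi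
  choose e he1 he2 using coord_clm
  have hval : ∀ n m, n ∈ M i → e n (P (Tb (chiSeq (M i))) (x m)) = a n (x m) := by
    intro n m hn
    have := hi (m, n)
    rw [hlv, lp.coeFn_sub, Pi.sub_apply, hTn, chiSeq_apply, Set.indicator_of_mem hn] at this
    rw [he2]
    linarith
  refine aux_conv _ (hPW _ (hTD (chiSeq (M i)))) (fun m => P (Tb (chiSeq (M i))) (x m))
    (fun m => ⟨x m, hx m, rfl⟩) e 1 he1 (M i) (hMinf i) α β hαβ (fun n m hn hnm => ?_)
    (fun n m hn hnm => ?_)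
  · rw [hval n m hn]; exact c1 n m hnm
  · rw [hval n m hn]; exact c2 n m hnm

theorem stmt18 {X : Type*} [NormedAddCommGroup X] [NormedSpace ℝ X] [CompleteSpace X] :
    (HasLDPProperty X ↔ ∀ T : X →L[ℝ] ellInfty, IsDPcc T → IsWeaklyCompactOp T) ∧
    (HasLDPProperty X ↔
      OpComplementedIn {T : X →L[ℝ] ellInfty | IsWeaklyCompactOp T}
        {T : X →L[ℝ] ellInfty | IsDPcc T}) := by
  have h23 : (∀ T : X →L[ℝ] ellInfty, IsDPcc T → IsWeaklyCompactOp T) →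
      OpComplementedIn {T : X →L[ℝ] ellInfty | IsWeaklyCompactOp T}
        {T : X →L[ℝ] ellInfty | IsDPcc T} := fun h =>
    ⟨id, fun _ _ _ _ => rfl, fun _ _ _ => rfl, ⟨1, fun T _ => by simp⟩, fun T hT => h T hT,
      fun _ _ => rfl⟩
  exact ⟨⟨aux_12, fun h => aux_31 (h23 h)⟩, ⟨fun h => h23 (aux_12 h), aux_31⟩⟩
end
end
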